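/- arXiv:2209.14050 — 3 statements merged into one kernel-verified Lean document; each statement's English description precedes it below -/
import Mathlib

section
/- Let H_r ∈ ℂ^{n_r×n_t} and H_e ∈ ℂ^{n_e×n_t} satisfy Δ := H_r^H H_r − H_e^H H_e ≻ 0, let K be an n_t×n_t Hermitian positive definite matrix, and let K̃ be an n_t×n_t complex symmetric matrix with the augmented covariance matrix K̲ = [[K, K̃],[K̃^*, K^*]] positive semidefinite. Then equality holds in (1/2)·log det(I_{2n_r} + H̲_r K̲ H̲_r^H) − (1/2)·log det(I_{2n_e} + H̲_e K̲ H̲_e^H) ≤ log det(I_{n_r} + H_r K H_r^H) − log det(I_{n_e} + H_e K H_e^H) if and only if K̃ = 0, i.e., if and only if the signal with covariance K and pseudo-covariance K̃ is proper. -/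
open Matrix
open scoped ComplexOrder

/-- Entrywise complex conjugate of a matrix. -/
def mconj {m n : Type*} (M : Matrix m n ℂ) : Matrix m n ℂ := M.map (starRingEnd ℂ)

/-- The augmented channel matrix `H̲ = [[H, 0], [0, H*]]`. -/
def augChannel {m n : ℕ} (H : Matrix (Fin m) (Fin n) ℂ) :
    Matrix (Fin m ⊕ Fin m) (Fin n ⊕ Fin n) ℂ :=
  Matrix.fromBlocks H 0 0 (mconj H)

/-- The augmented covariance matrix `K̲ = [[K, K̃], [K̃*, K*]]`. -/
def augCov {n : ℕ} (K Kt : Matrix (Fin n) (Fin n) ℂ) :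
    Matrix (Fin n ⊕ Fin n) (Fin n ⊕ Fin n) ℂ :=
  Matrix.fromBlocks K Kt (mconj Kt) (mconj K)

namespace Matrix

open scoped MatrixOrder

variable {m n : Type*} [Fintype m] [DecidableEq m] [Fintype n] [DecidableEq n]

lemma PosSemidef.exists_eq_conjTranspose_mul_self {A : Matrix n n ℂ} (hA : A.PosSemidef) :
    ∃ R : Matrix n n ℂ, A = Rᴴ * R :=
  CStarAlgebra.nonneg_iff_eq_star_mul_self.mp hA.nonneg

lemma IsHermitian.det_one_add {A : Matrix n n ℂ} (hA : A.IsHermitian) :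
    (1 + A).det = ((∏ i, (1 + hA.eigenvalues i) : ℝ) : ℂ) := by
  have h : 1 + A = Unitary.conjStarAlgAut ℂ _ hA.eigenvectorUnitary
      (1 + diagonal (RCLike.ofReal ∘ hA.eigenvalues)) := by
    rw [map_add, map_one, ← hA.spectral_theorem]
  rw [h, det_map, ← diagonal_one, diagonal_add, det_diagonal]
  simp

lemma PosSemidef.one_add_trace_le_det_one_add {A : Matrix n n ℂ} (hA : A.PosSemidef) :
    1 + A.trace ≤ (1 + A).det := by
  have key : ∀ s : Finset n, 1 + ∑ i ∈ s, hA.1.eigenvalues i ≤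
      ∏ i ∈ s, (1 + hA.1.eigenvalues i) := by
    intro s
    induction s using Finset.induction_on with
    | empty => simp
    | insert a s ha ih =>
      rw [Finset.sum_insert ha, Finset.prod_insert ha]
      have h1 := hA.eigenvalues_nonneg a
      have h2 : 0 ≤ ∑ i ∈ s, hA.1.eigenvalues i :=
        Finset.sum_nonneg fun i _ => hA.eigenvalues_nonneg i
      nlinarith
  rw [hA.1.det_one_add, hA.1.trace_eq_sum_eigenvalues]
  have := Complex.real_le_real.2 (key Finset.univ)
  simpa using this

lemma PosDef.exists_det_add_eq {P : Matrix n n ℂ} (hP : P.PosDef) (Q : Matrix n n ℂ) :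
    ∃ R : Matrix n n ℂ, IsUnit R ∧ (P + Q).det = P.det * (1 + R * Q * Rᴴ).det := by
  obtain ⟨R, hR⟩ := hP.inv.posSemidef.exists_eq_conjTranspose_mul_self
  refine ⟨R, ?_, ?_⟩
  · have h := hP.inv.isUnit
    rw [hR, isUnit_iff_isUnit_det, det_mul] at h
    exact (isUnit_iff_isUnit_det R).2 (isUnit_of_mul_isUnit_right h)
  · have h : P + Q = P * (1 + P⁻¹ * Q) := by
      rw [Matrix.mul_add, Matrix.mul_one, ← Matrix.mul_assoc,
        mul_nonsing_inv _ ((isUnit_iff_isUnit_det P).1 hP.isUnit), Matrix.one_mul]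
    rw [h, det_mul, hR, Matrix.mul_assoc, det_one_add_mul_comm]

lemma PosDef.det_le_det_add {P Q : Matrix n n ℂ} (hP : P.PosDef) (hQ : Q.PosSemidef) :
    P.det ≤ (P + Q).det := by
  obtain ⟨R, -, h⟩ := hP.exists_det_add_eq Q
  have hRQ := hQ.mul_mul_conjTranspose_same R
  rw [h]
  refine le_mul_of_one_le_right hP.det_pos.le (le_trans ?_ hRQ.one_add_trace_le_det_one_add)
  exact le_add_of_nonneg_right hRQ.trace_nonneg

lemma PosDef.eq_zero_of_det_add_le {P Q : Matrix n n ℂ} (hP : P.PosDef) (hQ : Q.PosSemidef)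
    (h : (P + Q).det ≤ P.det) : Q = 0 := by
  obtain ⟨R, hR, hdet⟩ := hP.exists_det_add_eq Q
  have hRQ := hQ.mul_mul_conjTranspose_same R
  have h1 : (1 + R * Q * Rᴴ).det = 1 := by
    have := hdet.symm.trans (h.antisymm (hP.det_le_det_add hQ))
    exact mul_left_cancel₀ hP.det_pos.ne' (this.trans (mul_one _).symm)
  have h2 : (R * Q * Rᴴ).trace ≤ 0 := by
    have := hRQ.one_add_trace_le_det_one_add
    rw [h1] at this
    exact (add_le_iff_nonpos_right 1).1 this
  have h3 := hRQ.trace_eq_zero_iff.1 (h2.antisymm hRQ.trace_nonneg)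
  have h4 : IsUnit Rᴴ := hR.star
  rwa [h4.mul_left_eq_zero, hR.mul_right_eq_zero] at h3

lemma PosDef.det_one_add_mul {D : Matrix n n ℂ} (hD : D.PosDef) (L : Matrix n n ℂ) :
    (1 + L * D).det = (D⁻¹ + L).det * D.det := by
  rw [← det_mul, Matrix.add_mul, nonsing_inv_mul _ ((isUnit_iff_isUnit_det D).1 hD.isUnit)]

lemma PosSemidef.det_one_add_mul_pos {G K : Matrix n n ℂ} (hG : G.PosSemidef)
    (hK : K.PosSemidef) : 0 < (1 + K * G).det := by
  obtain ⟨R, rfl⟩ := hG.exists_eq_conjTranspose_mul_self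
  rw [← Matrix.mul_assoc, det_one_add_mul_comm, ← Matrix.mul_assoc]
  exact (PosDef.one.add_posSemidef (hK.mul_mul_conjTranspose_same R)).det_pos

/-- The error covariance of the linear minimum mean square error estimate of a signal with
covariance `K`, observed through a channel with Gram matrix `G` and unit noise. -/
noncomputable def errorCov (G K : Matrix n n ℂ) : Matrix n n ℂ := (1 + K * G)⁻¹ * K

section errorCov

variable {G K : Matrix n n ℂ}

lemma one_add_mul_mul_errorCov (hG : G.PosSemidef) (hK : K.PosSemidef) :
    (1 + K * G) * errorCov G K = K := by
  rw [errorCov, ← Matrix.mul_assoc,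
    mul_nonsing_inv _ (hG.det_one_add_mul_pos hK).ne'.isUnit, Matrix.one_mul]

lemma errorCov_posSemidef (hG : G.PosSemidef) (hK : K.PosSemidef) :
    (errorCov G K).PosSemidef := by
  have h : errorCov G K = (1 + K * G)⁻¹ * (K + K * G * Kᴴ) * (1 + K * G)⁻¹ᴴ := by
    have h1 : K + K * G * Kᴴ = K * (1 + K * G)ᴴ := by
      simp [Matrix.mul_add, hG.1.eq, hK.1.eq, Matrix.mul_assoc]
    rw [h1, Matrix.mul_assoc, Matrix.mul_assoc, ← conjTranspose_mul,
      nonsing_inv_mul _ (hG.det_one_add_mul_pos hK).ne'.isUnit, conjTranspose_one,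
      Matrix.mul_one, errorCov]
  rw [h]
  exact (hK.add (hG.mul_mul_conjTranspose_same K)).mul_mul_conjTranspose_same _

lemma errorCov_mul_one_add_mul (hG : G.PosSemidef) (hK : K.PosSemidef) :
    errorCov G K * (1 + G * K) = K := by
  have h := congrArg conjTranspose (one_add_mul_mul_errorCov hG hK)
  simpa [hG.1.eq, hK.1.eq, (errorCov_posSemidef hG hK).1.eq] using h

/-- Excess error covariance of a linear estimator `X` over the optimal one. -/
lemma estimator_errorCov_eq (hG : G.PosSemidef) (hK : K.PosSemidef)
    (X : Matrix n n ℂ) :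
    (1 - X * G) * K * (1 - X * G)ᴴ + X * G * Xᴴ =
      errorCov G K + (X - errorCov G K) * (G + G * K * Gᴴ) * (X - errorCov G K)ᴴ := by
  have h1 := one_add_mul_mul_errorCov hG hK
  have h2 := errorCov_mul_one_add_mul hG hK
  have hL := (errorCov_posSemidef hG hK).1.eq
  simp only [conjTranspose_sub, conjTranspose_mul, conjTranspose_one, hG.1.eq, hL]
  generalize errorCov G K = L at *
  generalize Xᴴ = Y
  have e1 : (X - L) * (G + G * K * G) * (Y - L) = X * (G + G * K * G) * Y
      - X * G * ((1 + K * G) * L) - (L * (1 + G * K)) * G * Y + L * G * ((1 + K * G) * L) := by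
    noncomm_ring
  have e2 : L * G * K = K - L := by
    rw [eq_sub_iff_add_eq']
    simpa [Matrix.mul_add, Matrix.mul_assoc] using h2
  rw [e1, h1, h2, e2]
  noncomm_ring

lemma det_one_add_mul_add (hG : G.PosSemidef) (hK : K.PosSemidef)
    (D : Matrix n n ℂ) :
    (1 + K * (G + D)).det = (1 + K * G).det * (1 + errorCov G K * D).det := by
  rw [← det_mul, Matrix.mul_add (1 + K * G), ← Matrix.mul_assoc,
    one_add_mul_mul_errorCov hG hK, Matrix.mul_one, Matrix.mul_add, add_assoc]

end errorCov

lemma PosSemidef.fromBlocks_diagonal {A : Matrix m m ℂ} {D : Matrix n n ℂ}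
    (hA : A.PosSemidef) (hD : D.PosSemidef) : (fromBlocks A 0 0 D).PosSemidef := by
  obtain ⟨R, rfl⟩ := hA.exists_eq_conjTranspose_mul_self
  obtain ⟨S, rfl⟩ := hD.exists_eq_conjTranspose_mul_self
  have h := posSemidef_conjTranspose_mul_self (fromBlocks R 0 0 S)
  simpa [fromBlocks_conjTranspose, fromBlocks_multiply] using h

lemma PosDef.fromBlocks_diagonal {A : Matrix m m ℂ} {D : Matrix n n ℂ}
    (hA : A.PosDef) (hD : D.PosDef) : (fromBlocks A 0 0 D).PosDef := by
  rw [(hA.posSemidef.fromBlocks_diagonal hD.posSemidef).posDef_iff_det_ne_zero,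
    det_fromBlocks_zero₂₁]
  exact mul_ne_zero hA.det_pos.ne' hD.det_pos.ne'

/-- The equality case of Fischer's inequality, with dominated diagonal blocks. -/
lemma PosDef.fromBlocks_eq_zero_of_det_le {P P₀ : Matrix m m ℂ} {Q Q₀ : Matrix n n ℂ}
    {B : Matrix m n ℂ} (h : (fromBlocks P B Bᴴ Q).PosDef) (hP₀ : (P₀ - P).PosSemidef)
    (hQ₀ : (Q₀ - Q).PosSemidef) (hdet : P₀.det * Q₀.det ≤ (fromBlocks P B Bᴴ Q).det) :
    B = 0 := by
  have hP : P.PosDef := h.submatrix (e := Sum.inl) Sum.inl_injective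
  have hQ : Q.PosDef := h.submatrix (e := Sum.inr) Sum.inr_injective
  let : Invertible P := hP.isUnit.invertible
  have hT := (PosDef.fromBlocks₁₁ B Q hP).1 h.posSemidef
  have hM : (fromBlocks P B Bᴴ Q).det = P.det * (Q - Bᴴ * P⁻¹ * B).det := by
    rw [det_fromBlocks₁₁, invOf_eq_nonsing_inv]
  have hT' : (Q - Bᴴ * P⁻¹ * B).PosDef := by
    rw [hT.posDef_iff_det_ne_zero]
    exact right_ne_zero_of_mul (hM ▸ h.det_pos.ne')
  have hPP₀ : P.det ≤ P₀.det := by simpa using hP.det_le_det_add hP₀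
  have hQQ₀ : Q.det ≤ Q₀.det := by simpa using hQ.det_le_det_add hQ₀
  have hle : Q₀.det ≤ (Q - Bᴴ * P⁻¹ * B).det := by
    refine le_of_mul_le_mul_left ?_ (hP.det_pos.trans_le hPP₀)
    exact (hdet.trans_eq hM).trans (mul_le_mul_of_nonneg_right hPP₀ hT'.det_pos.le)
  have hS := hT'.eq_zero_of_det_add_le (hP.inv.posSemidef.conjTranspose_mul_mul_same B)
    (by simpa using hQQ₀.trans hle)
  obtain ⟨R, hR⟩ := hP.inv.posSemidef.exists_eq_conjTranspose_mul_self
  have hRB : (R * B)ᴴ * (R * B) = 0 := by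
    rw [← hS, hR, conjTranspose_mul]
    simp only [Matrix.mul_assoc]
  rw [conjTranspose_mul_self_eq_zero] at hRB
  have hPB : P⁻¹ * B = 0 := by rw [hR, Matrix.mul_assoc, hRB, Matrix.mul_zero]
  rw [← Matrix.one_mul B, ← mul_nonsing_inv P ((isUnit_iff_isUnit_det P).1 hP.isUnit),
    Matrix.mul_assoc, hPB, Matrix.mul_zero]

section blocks

variable {G₁ K₁ D₁ : Matrix m m ℂ} {G₂ K₂ D₂ : Matrix n n ℂ} {B : Matrix m n ℂ}

/-- Joint estimation from both observations beats estimating each block from its own one. -/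
lemma errorCov_fromBlocks_le (hG₁ : G₁.PosSemidef) (hG₂ : G₂.PosSemidef)
    (hK : (fromBlocks K₁ B Bᴴ K₂).PosSemidef) :
    ∃ (A₁ : Matrix m m ℂ) (C : Matrix m n ℂ) (A₂ : Matrix n n ℂ),
      errorCov (fromBlocks G₁ 0 0 G₂) (fromBlocks K₁ B Bᴴ K₂) = fromBlocks A₁ C Cᴴ A₂ ∧
        (errorCov G₁ K₁ - A₁).PosSemidef ∧ (errorCov G₂ K₂ - A₂).PosSemidef := by
  have hK₁ : K₁.PosSemidef := hK.submatrix Sum.inl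
  have hK₂ : K₂.PosSemidef := hK.submatrix Sum.inr
  have hG := hG₁.fromBlocks_diagonal hG₂
  have hL := errorCov_posSemidef hG hK
  set L := errorCov (fromBlocks G₁ 0 0 G₂) (fromBlocks K₁ B Bᴴ K₂)
  have hblk : L.toBlocks₂₁ = L.toBlocks₁₂ᴴ := by
    ext i j
    exact (hL.1.apply _ _).symm
  set X := fromBlocks (errorCov G₁ K₁) 0 0 (errorCov G₂ K₂) with hX
  have e := estimator_errorCov_eq hG hK X
  have hexc := (hG.add (hK.mul_mul_conjTranspose_same
    (fromBlocks G₁ 0 0 G₂))).mul_mul_conjTranspose_same (X - L)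
  rw [hG.1.eq] at hexc e
  rw [← sub_eq_iff_eq_add'] at e
  rw [← e] at hexc
  have e₁ := estimator_errorCov_eq hG₁ hK₁ (errorCov G₁ K₁)
  have e₂ := estimator_errorCov_eq hG₂ hK₂ (errorCov G₂ K₂)
  have hXG : 1 - X * fromBlocks G₁ 0 0 G₂ =
      fromBlocks (1 - errorCov G₁ K₁ * G₁) 0 0 (1 - errorCov G₂ K₂ * G₂) := by
    rw [hX, fromBlocks_multiply, ← fromBlocks_one, sub_eq_add_neg, fromBlocks_neg,
      fromBlocks_add]
    simp [sub_eq_add_neg]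
  rw [hXG, hX] at hexc
  simp only [fromBlocks_conjTranspose, fromBlocks_multiply, fromBlocks_add, conjTranspose_zero,
    Matrix.zero_mul, Matrix.mul_zero, add_zero, zero_add] at hexc
  simp only [sub_self, Matrix.zero_mul, add_zero] at e₁ e₂
  rw [e₁, e₂] at hexc
  refine ⟨L.toBlocks₁₁, L.toBlocks₁₂, L.toBlocks₂₂, ?_, hexc.submatrix Sum.inl,
    hexc.submatrix Sum.inr⟩
  rw [← hblk, fromBlocks_toBlocks]

lemma eq_zero_of_det_one_add_mul_add_eq (hG₁ : G₁.PosSemidef) (hG₂ : G₂.PosSemidef)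
    (hK : (fromBlocks K₁ B Bᴴ K₂).PosSemidef)
    (hD₁ : D₁.PosDef) (hD₂ : D₂.PosDef)
    (h : (1 + fromBlocks K₁ B Bᴴ K₂ * (fromBlocks G₁ 0 0 G₂ + fromBlocks D₁ 0 0 D₂)).det
        * ((1 + K₁ * G₁).det * (1 + K₂ * G₂).det) =
      (1 + fromBlocks K₁ B Bᴴ K₂ * fromBlocks G₁ 0 0 G₂).det
        * ((1 + K₁ * (G₁ + D₁)).det * (1 + K₂ * (G₂ + D₂)).det)) :
    B = 0 := by
  have hK₁ : K₁.PosSemidef := hK.submatrix Sum.inl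
  have hK₂ : K₂.PosSemidef := hK.submatrix Sum.inr
  have hG := hG₁.fromBlocks_diagonal hG₂
  have hD := hD₁.fromBlocks_diagonal hD₂
  have hDinv : (fromBlocks D₁ 0 0 D₂)⁻¹ = fromBlocks D₁⁻¹ 0 0 D₂⁻¹ := by
    refine inv_eq_left_inv ?_
    simp [fromBlocks_multiply,
      nonsing_inv_mul _ ((isUnit_iff_isUnit_det D₁).1 hD₁.isUnit),
      nonsing_inv_mul _ ((isUnit_iff_isUnit_det D₂).1 hD₂.isUnit)]
  obtain ⟨A₁, C, A₂, hL, hA₁, hA₂⟩ := errorCov_fromBlocks_le hG₁ hG₂ hK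
  have hM := hD.inv.add_posSemidef (errorCov_posSemidef hG hK)
  rw [det_one_add_mul_add hG hK, det_one_add_mul_add hG₁ hK₁, det_one_add_mul_add hG₂ hK₂,
    hD.det_one_add_mul, hD₁.det_one_add_mul, hD₂.det_one_add_mul, det_fromBlocks_zero₂₁] at h
  rw [hDinv, hL, fromBlocks_add, zero_add, zero_add] at hM h
  have hC : C = 0 := by
    refine hM.fromBlocks_eq_zero_of_det_le (P₀ := D₁⁻¹ + errorCov G₁ K₁)
      (Q₀ := D₂⁻¹ + errorCov G₂ K₂) (by simpa using hA₁) (by simpa using hA₂) (le_of_eq ?_)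
    have n0 := (hG.det_one_add_mul_pos hK).ne'
    have n1 := (hG₁.det_one_add_mul_pos hK₁).ne'
    have n2 := (hG₂.det_one_add_mul_pos hK₂).ne'
    have n3 := hD₁.det_pos.ne'
    have n4 := hD₂.det_pos.ne'
    refine mul_left_cancel₀ (mul_ne_zero (mul_ne_zero (mul_ne_zero n0 n1)
      (mul_ne_zero n2 n3)) n4) ?_
    linear_combination -h
  have hLK := errorCov_mul_one_add_mul hG hK
  rw [hL, hC, ← fromBlocks_one, fromBlocks_multiply, fromBlocks_add, fromBlocks_multiply,
    fromBlocks_inj] at hLK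
  obtain ⟨h11, h12, -, -⟩ := hLK
  simp only [Matrix.zero_mul, zero_add, add_zero] at h11 h12
  have hA : (1 + K₁ * G₁) * A₁ = K₁ := by
    have hA₁' : A₁ᴴ = A₁ := by
      have := (errorCov_posSemidef hG hK).1.eq
      rw [hL, fromBlocks_conjTranspose, fromBlocks_inj] at this
      exact this.1
    simpa [hG₁.1.eq, hK₁.1.eq, hA₁'] using congrArg conjTranspose h11
  have h0 : (1 + K₁ * G₁) * B = K₁ * G₁ * B := by
    conv_lhs => rw [← h12, ← Matrix.mul_assoc, hA]
    rw [Matrix.mul_assoc]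
  simpa [Matrix.add_mul] using h0

end blocks

end Matrix

lemma mconj_eq_transpose {n : Type*} {A : Matrix n n ℂ} (hA : A.IsHermitian) :
    mconj A = Aᵀ := by
  conv_rhs => rw [← hA.eq]
  ext i j
  simp [mconj]

lemma mconj_eq_conjTranspose {n : Type*} {A : Matrix n n ℂ} (hA : Aᵀ = A) :
    mconj A = Aᴴ := by
  conv_rhs => rw [← hA]
  ext i j
  simp [mconj]

lemma det_one_add_mul_mul_conjTranspose {m n : Type*} [Fintype m] [DecidableEq m] [Fintype n]
    [DecidableEq n] (H : Matrix m n ℂ) (K : Matrix n n ℂ) :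
    (1 + H * K * Hᴴ).det = (1 + K * (Hᴴ * H)).det := by
  rw [Matrix.mul_assoc, det_one_add_mul_comm, Matrix.mul_assoc]

lemma det_one_add_transpose_mul_transpose {n : Type*} [Fintype n] [DecidableEq n]
    (K G : Matrix n n ℂ) : (1 + Kᵀ * Gᵀ).det = (1 + K * G).det := by
  rw [← transpose_mul, ← det_transpose, transpose_add, transpose_transpose, transpose_one,
    det_one_add_mul_comm]

lemma conjTranspose_augChannel_mul_self {m n : ℕ} (H : Matrix (Fin m) (Fin n) ℂ) :
    (augChannel H)ᴴ * augChannel H = fromBlocks (Hᴴ * H) 0 0 (Hᴴ * H)ᵀ := by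
  have h : (mconj H)ᴴ = Hᵀ := by
    ext i j
    simp [mconj]
  have h' : mconj H = (Hᴴ)ᵀ := by
    ext i j
    simp [mconj]
  rw [augChannel, fromBlocks_conjTranspose, fromBlocks_multiply, h, h', transpose_mul]
  simp

/-- In a degraded complex MIMO wiretap channel, for a Gaussian signal with positive definite
covariance `K` and pseudo-covariance `K̃`, the secrecy rate computed from the augmented
covariance matrix equals the secrecy rate of the proper signal with covariance `K`
if and only if `K̃ = 0`, i.e. iff the signal is proper. -/
theorem secrecy_rate_eq_proper_iff_proper (nt nr ne : ℕ)
    (Hr : Matrix (Fin nr) (Fin nt) ℂ) (He : Matrix (Fin ne) (Fin nt) ℂ)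
    (hdeg : (Hrᴴ * Hr - Heᴴ * He).PosDef)
    (K Kt : Matrix (Fin nt) (Fin nt) ℂ)
    (hK : K.PosDef) (hKt : Ktᵀ = Kt)
    (haug : (augCov K Kt).PosSemidef) :
    (1 / 2) * Real.log ((1 + augChannel Hr * augCov K Kt * (augChannel Hr)ᴴ).det).re
      - (1 / 2) * Real.log ((1 + augChannel He * augCov K Kt * (augChannel He)ᴴ).det).re
    = Real.log ((1 + Hr * K * Hrᴴ).det).re - Real.log ((1 + He * K * Heᴴ).det).re
    ↔ Kt = 0 := by
  have hGr := posSemidef_conjTranspose_mul_self Hr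
  have hGe := posSemidef_conjTranspose_mul_self He
  have hcov : augCov K Kt = fromBlocks K Kt Ktᴴ Kᵀ := by
    rw [augCov, mconj_eq_conjTranspose hKt, mconj_eq_transpose hK.1]
  rw [hcov] at haug ⊢
  simp only [det_one_add_mul_mul_conjTranspose, conjTranspose_augChannel_mul_self]
  have hGr2 := hGr.fromBlocks_diagonal hGr.transpose
  have hGe2 := hGe.fromBlocks_diagonal hGe.transpose
  generalize Hrᴴ * Hr = Gr at *
  generalize Heᴴ * He = Ge at *
  have toReal {z : ℂ} (hz : 0 < z) : 0 < z.re ∧ z = (z.re : ℂ) :=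
    ⟨(Complex.pos_iff.1 hz).1, Complex.ext rfl (Complex.pos_iff.1 hz).2.symm⟩
  obtain ⟨pr, er⟩ := toReal (hGr.det_one_add_mul_pos hK.posSemidef)
  obtain ⟨pe, ee⟩ := toReal (hGe.det_one_add_mul_pos hK.posSemidef)
  obtain ⟨pr2, er2⟩ := toReal (hGr2.det_one_add_mul_pos haug)
  obtain ⟨pe2, ee2⟩ := toReal (hGe2.det_one_add_mul_pos haug)
  constructor
  · intro h
    have hlog : Real.log ((1 + fromBlocks K Kt Ktᴴ Kᵀ * fromBlocks Gr 0 0 Grᵀ).det.re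
          * ((1 + K * Ge).det.re * (1 + K * Ge).det.re)) =
        Real.log ((1 + fromBlocks K Kt Ktᴴ Kᵀ * fromBlocks Ge 0 0 Geᵀ).det.re
          * ((1 + K * Gr).det.re * (1 + K * Gr).det.re)) := by
      rw [Real.log_mul pr2.ne' (mul_pos pe pe).ne', Real.log_mul pe.ne' pe.ne',
        Real.log_mul pe2.ne' (mul_pos pr pr).ne', Real.log_mul pr.ne' pr.ne']
      linarith
    have hmul := congrArg (fun x : ℝ => (x : ℂ)) (Real.log_injOn_pos
      (mul_pos pr2 (mul_pos pe pe)) (mul_pos pe2 (mul_pos pr pr)) hlog)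
    simp only [Complex.ofReal_mul, ← er, ← ee, ← er2, ← ee2] at hmul
    refine eq_zero_of_det_one_add_mul_add_eq hGe hGe.transpose haug hdeg hdeg.transpose ?_
    rw [fromBlocks_add, ← transpose_add]
    simp only [add_sub_cancel, add_zero, det_one_add_transpose_mul_transpose]
    exact hmul
  · rintro rfl
    have hdet (G : Matrix (Fin nt) (Fin nt) ℂ) :
        (1 + fromBlocks K 0 0ᴴ Kᵀ * fromBlocks G 0 0 Gᵀ).det =
          (1 + K * G).det * (1 + K * G).det := by
      rw [conjTranspose_zero, fromBlocks_multiply, ← fromBlocks_one, fromBlocks_add]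
      simp only [Matrix.zero_mul, Matrix.mul_zero, add_zero, zero_add, det_fromBlocks_zero₂₁,
        det_one_add_transpose_mul_transpose]
    rw [hdet, hdet, er, ee, ← Complex.ofReal_mul, ← Complex.ofReal_mul]
    simp only [Complex.ofReal_re]
    rw [Real.log_mul pr.ne' pr.ne', Real.log_mul pe.ne' pe.ne']
    ring
end

section
/- Let H_r ∈ ℂ^{n_r×n_t}, H_e ∈ ℂ^{n_e×n_t} and P > 0. Define C_g as the supremum over all augmented covariance matrices K̲ = [[K, K̃],[K̃^*, K^*]] ⪰ 0 with tr(K̲) ≤ 2P of (1/2)·log det(I_{2n_r} + H̲_r K̲ H̲_r^H) − (1/2)·log det(I_{2n_e} + H̲_e K̲ H̲_e^H), where H̲_r = [[H_r,0],[0,H_r^*]] and H̲_e = [[H_e,0],[0,H_e^*]], and define C_p as the supremum over all n_t×n_t Hermitian positive semidefinite K with tr(K) ≤ P of log det(I_{n_r} + H_r K H_r^H) − log det(I_{n_e} + H_e K H_e^H). Then C_g = C_p; that is, the secrecy capacity of the general complex MIMO wiretap channel is achieved by proper signals (no degradedness assumption is required). -/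
open Matrix
open scoped ComplexOrder

/-- The general feasible set: augmented covariance matrices
`K̲ = [[K, K̃], [K̃*, K*]] ⪰ 0` with `K` Hermitian PSD, `K̃` symmetric, `tr(K̲) ≤ 2P`. -/
def feasibleGeneral (nt : ℕ) (P : ℝ) :
    Set (Matrix (Fin nt ⊕ Fin nt) (Fin nt ⊕ Fin nt) ℂ) :=
  {M | ∃ K Kt : Matrix (Fin nt) (Fin nt) ℂ, K.PosSemidef ∧ Ktᵀ = Kt ∧
    M = Matrix.fromBlocks K Kt (mconj Kt) (mconj K) ∧ M.PosSemidef ∧ M.trace.re ≤ 2 * P}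

section Schur

variable {m₁ m₂ n₁ n₂ : Type*} [Fintype m₁] [Fintype m₂] [Fintype n₁] [Fintype n₂]
  [DecidableEq m₁] [DecidableEq m₂]

/-- The covariance of the input remaining after observing a correlated Gaussian input of
covariance `D` through the channel `H`, where `A` is the prior covariance and `B` the
cross-covariance. -/
noncomputable def condCov (H : Matrix m₂ n₂ ℂ) (A : Matrix n₁ n₁ ℂ) (B : Matrix n₁ n₂ ℂ)
    (D : Matrix n₂ n₂ ℂ) : Matrix n₁ n₁ ℂ :=
  A - B * Hᴴ * (1 + H * D * Hᴴ)⁻¹ * (H * Bᴴ)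

lemma posDef_one_add_mul_mul_conjTranspose {D : Matrix n₂ n₂ ℂ} (hD : D.PosSemidef)
    (H : Matrix m₂ n₂ ℂ) : (1 + H * D * Hᴴ).PosDef :=
  PosDef.one.add_posSemidef (hD.mul_mul_conjTranspose_same H)

omit [Fintype n₁] [Fintype n₂] in
lemma posSemidef_toBlocks₁₁ {A : Matrix n₁ n₁ ℂ} {B : Matrix n₁ n₂ ℂ} {C : Matrix n₂ n₁ ℂ}
    {D : Matrix n₂ n₂ ℂ} (hM : (fromBlocks A B C D).PosSemidef) : A.PosSemidef := by
  have h := hM.submatrix Sum.inl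
  exact h

omit [Fintype n₁] [Fintype n₂] in
lemma posSemidef_toBlocks₂₂ {A : Matrix n₁ n₁ ℂ} {B : Matrix n₁ n₂ ℂ} {C : Matrix n₂ n₁ ℂ}
    {D : Matrix n₂ n₂ ℂ} (hM : (fromBlocks A B C D).PosSemidef) : D.PosSemidef := by
  have h := hM.submatrix Sum.inr
  exact h

omit [Fintype n₁] [Fintype n₂] in
lemma posSemidef_fromBlocks_swap {A : Matrix n₁ n₁ ℂ} {B : Matrix n₁ n₂ ℂ} {C : Matrix n₂ n₁ ℂ}
    {D : Matrix n₂ n₂ ℂ} (hM : (fromBlocks A B C D).PosSemidef) :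
    (fromBlocks D C B A).PosSemidef := by
  simpa using hM.submatrix Sum.swap

lemma posSemidef_fromBlocks_zero_zero {A : Matrix n₁ n₁ ℂ} {D : Matrix n₂ n₂ ℂ}
    (hA : A.PosSemidef) (hD : D.PosSemidef) : (fromBlocks A 0 0 D).PosSemidef := by
  classical
  have h₁ := hA.mul_mul_conjTranspose_same (fromRows (1 : Matrix n₁ n₁ ℂ) (0 : Matrix n₂ n₁ ℂ))
  have h₂ := hD.mul_mul_conjTranspose_same (fromRows (0 : Matrix n₁ n₂ ℂ) (1 : Matrix n₂ n₂ ℂ))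
  convert h₁.add h₂ using 1
  ext (i | i) (j | j) <;>
    simp [fromRows_mul, conjTranspose_fromRows_eq_fromCols_conjTranspose]

lemma trace_fromBlocks_eq (A : Matrix n₁ n₁ ℂ) (B : Matrix n₁ n₂ ℂ) (C : Matrix n₂ n₁ ℂ)
    (D : Matrix n₂ n₂ ℂ) : (fromBlocks A B C D).trace = A.trace + D.trace := by
  simp [trace]

lemma posSemidef_condCov (H : Matrix m₂ n₂ ℂ) {A : Matrix n₁ n₁ ℂ} {B : Matrix n₁ n₂ ℂ}
    {D : Matrix n₂ n₂ ℂ} (hM : (fromBlocks A B Bᴴ D).PosSemidef) :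
    (condCov H A B D).PosSemidef := by
  classical
  have hQ := posDef_one_add_mul_mul_conjTranspose (posSemidef_toBlocks₂₂ hM) H
  let _ : Invertible (1 + H * D * Hᴴ) := hQ.isUnit.invertible
  have h1 := hM.mul_mul_conjTranspose_same (fromBlocks (1 : Matrix n₁ n₁ ℂ) 0 0 H)
  have h2 := posSemidef_fromBlocks_zero_zero (PosSemidef.zero (n := n₁) (R := ℂ))
    (PosSemidef.one (n := m₂) (R := ℂ))
  have h3 : (fromBlocks A (B * Hᴴ) (B * Hᴴ)ᴴ (1 + H * D * Hᴴ)).PosSemidef := by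
    have h := h1.add h2
    simpa [fromBlocks_multiply, fromBlocks_conjTranspose, fromBlocks_add, add_comm] using h
  simpa [condCov] using (PosDef.fromBlocks₂₂ A (B * Hᴴ) hQ).1 h3

lemma trace_condCov_le (H : Matrix m₂ n₂ ℂ) (A : Matrix n₁ n₁ ℂ) (B : Matrix n₁ n₂ ℂ)
    {D : Matrix n₂ n₂ ℂ} (hD : D.PosSemidef) :
    (condCov H A B D).trace.re ≤ A.trace.re := by
  have h := ((posDef_one_add_mul_mul_conjTranspose hD H).inv.posSemidef.mul_mul_conjTranspose_same
    (B * Hᴴ)).trace_nonneg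
  have h' := (Complex.le_def.1 h).1
  simp only [conjTranspose_mul, conjTranspose_conjTranspose] at h'
  simpa [condCov, trace_sub] using h'

lemma det_one_add_fromBlocks (H₁ : Matrix m₁ n₁ ℂ) (H₂ : Matrix m₂ n₂ ℂ) (A : Matrix n₁ n₁ ℂ)
    (B : Matrix n₁ n₂ ℂ) {D : Matrix n₂ n₂ ℂ} (hD : D.PosSemidef) :
    (1 + fromBlocks H₁ 0 0 H₂ * fromBlocks A B Bᴴ D * (fromBlocks H₁ 0 0 H₂)ᴴ).det =
      (1 + H₂ * D * H₂ᴴ).det * (1 + H₁ * condCov H₂ A B D * H₁ᴴ).det := by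
  let _ : Invertible (1 + H₂ * D * H₂ᴴ) :=
    (posDef_one_add_mul_mul_conjTranspose hD H₂).isUnit.invertible
  rw [← fromBlocks_one, fromBlocks_conjTranspose, fromBlocks_multiply, fromBlocks_multiply,
    fromBlocks_add]
  simp only [conjTranspose_zero, Matrix.mul_zero, Matrix.zero_mul, add_zero, zero_add]
  rw [det_fromBlocks₂₂, invOf_eq_nonsing_inv, condCov]
  congr 2
  simp only [Matrix.mul_sub, Matrix.sub_mul, Matrix.mul_assoc]
  abel

lemma det_one_add_fromBlocks_swap (H₁ : Matrix m₁ n₁ ℂ) (H₂ : Matrix m₂ n₂ ℂ)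
    {A : Matrix n₁ n₁ ℂ} (B : Matrix n₁ n₂ ℂ) (D : Matrix n₂ n₂ ℂ) (hA : A.PosSemidef) :
    (1 + fromBlocks H₁ 0 0 H₂ * fromBlocks A B Bᴴ D * (fromBlocks H₁ 0 0 H₂)ᴴ).det =
      (1 + H₁ * A * H₁ᴴ).det * (1 + H₂ * condCov H₁ D Bᴴ A * H₂ᴴ).det := by
  rw [← det_one_add_fromBlocks H₂ H₁ D Bᴴ hA, ← det_submatrix_equiv_self (Equiv.sumComm m₂ m₁)]
  congr 1
  simp only [← fromBlocks_one, fromBlocks_conjTranspose, fromBlocks_multiply, fromBlocks_add]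
  ext (i | i) (j | j) <;> simp

end Schur

section LogDet

variable {m m₁ m₂ n n₁ n₂ : Type*} [Fintype m] [Fintype n] [DecidableEq m]
  [Fintype m₁] [Fintype m₂] [Fintype n₁] [Fintype n₂] [DecidableEq m₁] [DecidableEq m₂]

/-- The Gaussian mutual information `log det (1 + H K Hᴴ)`. -/
noncomputable def logDet (H : Matrix m n ℂ) (K : Matrix n n ℂ) : ℝ :=
  Real.log ((1 + H * K * Hᴴ).det).re

lemma log_re_mul {z w : ℂ} (hz : 0 < z) (hw : 0 < w) :
    Real.log (z * w).re = Real.log z.re + Real.log w.re := by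
  rw [Complex.lt_def] at hz hw
  simp only [Complex.zero_re, Complex.zero_im] at hz hw
  rw [Complex.mul_re, ← hz.2, zero_mul, sub_zero, Real.log_mul hz.1.ne' hw.1.ne']

lemma logDet_fromBlocks (H₁ : Matrix m₁ n₁ ℂ) (H₂ : Matrix m₂ n₂ ℂ) {A : Matrix n₁ n₁ ℂ}
    {B : Matrix n₁ n₂ ℂ} {D : Matrix n₂ n₂ ℂ} (hM : (fromBlocks A B Bᴴ D).PosSemidef) :
    logDet (fromBlocks H₁ 0 0 H₂) (fromBlocks A B Bᴴ D) =
      logDet H₂ D + logDet H₁ (condCov H₂ A B D) := by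
  have hD := posSemidef_toBlocks₂₂ hM
  rw [logDet, det_one_add_fromBlocks H₁ H₂ A B hD, log_re_mul
    (posDef_one_add_mul_mul_conjTranspose hD H₂).det_pos
    (posDef_one_add_mul_mul_conjTranspose (posSemidef_condCov H₂ hM) H₁).det_pos]
  rfl

lemma logDet_fromBlocks_swap (H₁ : Matrix m₁ n₁ ℂ) (H₂ : Matrix m₂ n₂ ℂ) {A : Matrix n₁ n₁ ℂ}
    {B : Matrix n₁ n₂ ℂ} {D : Matrix n₂ n₂ ℂ} (hM : (fromBlocks A B Bᴴ D).PosSemidef) :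
    logDet (fromBlocks H₁ 0 0 H₂) (fromBlocks A B Bᴴ D) =
      logDet H₁ A + logDet H₂ (condCov H₁ D Bᴴ A) := by
  have hA := posSemidef_toBlocks₁₁ hM
  have hM' : (fromBlocks D Bᴴ Bᴴᴴ A).PosSemidef := by
    simpa using posSemidef_fromBlocks_swap hM
  rw [logDet, det_one_add_fromBlocks_swap H₁ H₂ B D hA, log_re_mul
    (posDef_one_add_mul_mul_conjTranspose hA H₁).det_pos
    (posDef_one_add_mul_mul_conjTranspose (posSemidef_condCov H₁ hM') H₂).det_pos]
  rfl

/-- Single-letterization of the Gaussian secrecy rate of two parallel wiretap channels. -/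
lemma logDet_sub_logDet_fromBlocks {r₁ r₂ e₁ e₂ : Type*} [Fintype r₁] [Fintype r₂] [Fintype e₁]
    [Fintype e₂] [DecidableEq r₁] [DecidableEq r₂] [DecidableEq e₁] [DecidableEq e₂]
    (R₁ : Matrix r₁ n₁ ℂ) (R₂ : Matrix r₂ n₂ ℂ) (E₁ : Matrix e₁ n₁ ℂ) (E₂ : Matrix e₂ n₂ ℂ)
    {A : Matrix n₁ n₁ ℂ} {B : Matrix n₁ n₂ ℂ} {D : Matrix n₂ n₂ ℂ}
    (hM : (fromBlocks A B Bᴴ D).PosSemidef) :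
    logDet (fromBlocks R₁ 0 0 R₂) (fromBlocks A B Bᴴ D) -
        logDet (fromBlocks E₁ 0 0 E₂) (fromBlocks A B Bᴴ D) =
      (logDet R₁ (condCov R₂ A B D) - logDet E₁ (condCov R₂ A B D)) +
        (logDet R₂ (condCov E₁ D Bᴴ A) - logDet E₂ (condCov E₁ D Bᴴ A)) := by
  have h := logDet_fromBlocks_swap E₁ R₂ hM
  rw [logDet_fromBlocks E₁ R₂ hM] at h
  rw [logDet_fromBlocks R₁ R₂ hM, logDet_fromBlocks_swap E₁ E₂ hM]
  linarith

omit [Fintype n] [DecidableEq m] in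
lemma mconj_mul {l : Type*} (M : Matrix l m ℂ) (N : Matrix m n ℂ) :
    mconj (M * N) = mconj M * mconj N :=
  Matrix.map_mul

omit [Fintype m] [DecidableEq m] in
lemma mconj_mconj {l : Type*} (M : Matrix l m ℂ) : mconj (mconj M) = M := by
  ext; simp [mconj]

omit [Fintype n] in
lemma mconj_posSemidef {K : Matrix n n ℂ} (hK : K.PosSemidef) : (mconj K).PosSemidef := by
  have h : mconj K = Kᵀ := by
    ext i j
    simpa [mconj] using hK.isHermitian.apply j i
  exact h ▸ hK.transpose

lemma trace_mconj_re (K : Matrix n n ℂ) : (mconj K).trace.re = K.trace.re := by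
  simp [mconj, trace]

lemma logDet_mconj (H : Matrix m n ℂ) (K : Matrix n n ℂ) :
    logDet (mconj H) (mconj K) = logDet H K := by
  have h : 1 + mconj H * mconj K * (mconj H)ᴴ =
      (starRingEnd ℂ).mapMatrix (1 + H * K * Hᴴ) := by
    have hH : (mconj H)ᴴ = mconj Hᴴ := rfl
    rw [map_add, map_one, hH, ← mconj_mul, ← mconj_mul]
    rfl
  rw [logDet, h, ← RingHom.map_det, Complex.conj_re, logDet]

end LogDet

lemma mem_feasibleGeneral_of_proper {nt : ℕ} {P : ℝ} {K : Matrix (Fin nt) (Fin nt) ℂ}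
    (hK : K.PosSemidef) (hP : K.trace.re ≤ P) :
    fromBlocks K 0 0 (mconj K) ∈ feasibleGeneral nt P := by
  have hM := posSemidef_fromBlocks_zero_zero hK (mconj_posSemidef hK)
  refine ⟨K, 0, hK, by simp, ?_, hM, ?_⟩
  · congr 1
    ext; simp [mconj]
  · rw [trace_fromBlocks_eq, Complex.add_re, trace_mconj_re]
    linarith

lemma exists_proper_of_mem_feasibleGeneral {nt nr ne : ℕ} (Hr : Matrix (Fin nr) (Fin nt) ℂ)
    (He : Matrix (Fin ne) (Fin nt) ℂ) {P : ℝ}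
    {M : Matrix (Fin nt ⊕ Fin nt) (Fin nt ⊕ Fin nt) ℂ} (hM : M ∈ feasibleGeneral nt P) :
    ∃ K₁ K₂ : Matrix (Fin nt) (Fin nt) ℂ, (K₁.PosSemidef ∧ K₁.trace.re ≤ P) ∧
      (K₂.PosSemidef ∧ K₂.trace.re ≤ P) ∧
      logDet (augChannel Hr) M - logDet (augChannel He) M =
        (logDet Hr K₁ - logDet He K₁) + (logDet Hr K₂ - logDet He K₂) := by
  obtain ⟨K, Kt, hK, hKt, rfl, hM, htr⟩ := hM
  rw [trace_fromBlocks_eq, Complex.add_re, trace_mconj_re] at htr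
  have hB : mconj Kt = Ktᴴ := by
    rw [conjTranspose, hKt]; rfl
  rw [hB] at hM ⊢
  have hM' : (fromBlocks (mconj K) Ktᴴ Ktᴴᴴ K).PosSemidef := by
    simpa using posSemidef_fromBlocks_swap hM
  refine ⟨condCov (mconj Hr) K Kt (mconj K), mconj (condCov He (mconj K) Ktᴴ K),
    ⟨posSemidef_condCov _ hM, ?_⟩, ⟨mconj_posSemidef (posSemidef_condCov _ hM'), ?_⟩, ?_⟩
  · have := trace_condCov_le (mconj Hr) K Kt (mconj_posSemidef hK)
    linarith
  · have := trace_condCov_le He (mconj K) Ktᴴ hK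
    rw [trace_mconj_re] at this ⊢
    linarith
  · rw [augChannel, augChannel, logDet_sub_logDet_fromBlocks _ _ _ _ hM,
      ← logDet_mconj Hr (mconj _), ← logDet_mconj He (mconj _), mconj_mconj]

lemma logDet_augChannel_proper {m n : ℕ} (H : Matrix (Fin m) (Fin n) ℂ)
    {K : Matrix (Fin n) (Fin n) ℂ} (hK : K.PosSemidef) :
    logDet (augChannel H) (fromBlocks K 0 0 (mconj K)) = 2 * logDet H K := by
  obtain ⟨_, _, _, _, _, hM, _⟩ := mem_feasibleGeneral_of_proper hK le_rfl
  have h := logDet_fromBlocks (B := 0) H (mconj H) (A := K) (D := mconj K) (by simpa using hM)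
  simp only [conjTranspose_zero] at h
  rw [augChannel, h, logDet_mconj]
  simp [condCov]
  ring

/-- If `T` contains `S` and every element of `T` is a midpoint of two elements of `S`, then `S`
and `T` have the same supremum. -/
lemma sSup_eq_of_subset_of_midpoint {S T : Set ℝ} (hS : S.Nonempty) (hST : S ⊆ T)
    (hT : ∀ t ∈ T, ∃ a ∈ S, ∃ b ∈ S, 2 * t = a + b) : sSup T = sSup S := by
  by_cases hb : BddAbove S
  · have hle : ∀ t ∈ T, t ≤ sSup S := fun t ht => by
      obtain ⟨a, ha, b, hb', h⟩ := hT t ht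
      linarith [le_csSup hb ha, le_csSup hb hb']
    exact le_antisymm (csSup_le (hS.mono hST) hle) (csSup_le_csSup ⟨_, hle⟩ hS hST)
  · rw [Real.sSup_of_not_bddAbove hb, Real.sSup_of_not_bddAbove fun h => hb (h.mono hST)]

/-- **Optimality of proper signals for the general complex MIMO wiretap channel.** The
secrecy capacity `C_g` over all (possibly improper) complex Gaussian signals with augmented
covariance of trace at most `2P` equals the secrecy capacity `C_p` over proper Gaussian
signals with covariance of trace at most `P`; no degradedness assumption is required. -/
theorem secrecy_capacity_general_eq_proper (nt nr ne : ℕ)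
    (Hr : Matrix (Fin nr) (Fin nt) ℂ) (He : Matrix (Fin ne) (Fin nt) ℂ)
    (P : ℝ) (hP : 0 < P) :
    sSup ((fun M : Matrix (Fin nt ⊕ Fin nt) (Fin nt ⊕ Fin nt) ℂ =>
        (1 / 2) * Real.log ((1 + augChannel Hr * M * (augChannel Hr)ᴴ).det).re
        - (1 / 2) * Real.log ((1 + augChannel He * M * (augChannel He)ᴴ).det).re) ''
      feasibleGeneral nt P)
    = sSup ((fun K : Matrix (Fin nt) (Fin nt) ℂ =>
        Real.log ((1 + Hr * K * Hrᴴ).det).re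
        - Real.log ((1 + He * K * Heᴴ).det).re) ''
      {K : Matrix (Fin nt) (Fin nt) ℂ | K.PosSemidef ∧ K.trace.re ≤ P}) := by
  refine sSup_eq_of_subset_of_midpoint ⟨_, 0, ⟨PosSemidef.zero, by simpa using hP.le⟩, rfl⟩ ?_ ?_
  · rintro _ ⟨K, ⟨hK, hKP⟩, rfl⟩
    refine ⟨_, mem_feasibleGeneral_of_proper hK hKP, ?_⟩
    have h₁ := logDet_augChannel_proper Hr hK
    have h₂ := logDet_augChannel_proper He hK
    simp only [logDet] at h₁ h₂
    dsimp only
    rw [h₁, h₂]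
    ring
  · rintro _ ⟨M, hM, rfl⟩
    obtain ⟨K₁, K₂, h₁, h₂, h⟩ := exists_proper_of_mem_feasibleGeneral Hr He hM
    refine ⟨_, ⟨K₁, h₁, rfl⟩, _, ⟨K₂, h₂, rfl⟩, ?_⟩
    simp only [logDet] at h
    dsimp only
    rw [← h]
    ring
end

section
/- Let H_r ∈ ℂ^{n_r×n_t}, H_e ∈ ℂ^{n_e×n_t}, P > 0, and set H̲ = [H̲_r; H̲_e] ∈ ℂ^{2(n_r+n_e)×2n_t} with H̲_r = [[H_r,0],[0,H_r^*]], H̲_e = [[H_e,0],[0,H_e^*]]. Let 𝒦̲_g be the set of augmented covariance matrices K̲ = [[K, K̃],[K̃^*, K^*]] ⪰ 0 with tr(K̲) ≤ 2P, and let 𝒬̲ be the set of positive definite matrices of the form Q̲ = [[I_{2n_r}, A̲],[A̲^H, I_{2n_e}]] with A̲ = [[A, B],[B^*, A^*]], A, B ∈ ℂ^{n_r×n_e}. Then the supremum over K̲ ∈ 𝒦̲_g of (1/2)·log det(I_{2n_r} + H̲_r K̲ H̲_r^H) − (1/2)·log det(I_{2n_e} + H̲_e K̲ H̲_e^H) equals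 the infimum over Q̲ ∈ 𝒬̲ of the supremum over K̲ ∈ 𝒦̲_g of (1/2)·log det(I_{2(n_r+n_e)} + Q̲^{-1} H̲ K̲ H̲^H) − (1/2)·log det(I_{2n_e} + H̲_e K̲ H̲_e^H); i.e., the secrecy capacity of the general complex MIMO wiretap channel admits the min-max reformulation over augmented noise correlation matrices. -/
open Matrix
open scoped ComplexOrder

/-- The feasible set of augmented noise correlation matrices: positive definite matrices
`Q̲ = [[I, A̲], [A̲ᴴ, I]]` with `A̲ = [[A, B], [B*, A*]]`. -/
def feasibleNoiseCorr (nr ne : ℕ) :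
    Set (Matrix ((Fin nr ⊕ Fin nr) ⊕ (Fin ne ⊕ Fin ne))
      ((Fin nr ⊕ Fin nr) ⊕ (Fin ne ⊕ Fin ne)) ℂ) :=
  {Q | ∃ A B : Matrix (Fin nr) (Fin ne) ℂ,
    Q = Matrix.fromBlocks 1 (Matrix.fromBlocks A B (mconj B) (mconj A))
      (Matrix.fromBlocks A B (mconj B) (mconj A))ᴴ 1 ∧ Q.PosDef}

section LogDet

variable {n : Type*} [Fintype n] [DecidableEq n]

open scoped MatrixOrder in
lemma Matrix.PosSemidef.exists_eq_conjTranspose_mul_self_s13 {A : Matrix n n ℂ} (hA : A.PosSemidef) :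
    ∃ B : Matrix n n ℂ, A = Bᴴ * B :=
  CStarAlgebra.nonneg_iff_eq_star_mul_self.mp hA.nonneg

lemma Matrix.PosSemidef.trace_mul_nonneg {A B : Matrix n n ℂ} (hA : A.PosSemidef)
    (hB : B.PosSemidef) : 0 ≤ (A * B).trace := by
  obtain ⟨C, rfl⟩ := hB.exists_eq_conjTranspose_mul_self_s13
  rw [← mul_assoc, trace_mul_comm, ← mul_assoc]
  exact (hA.mul_mul_conjTranspose_same C).trace_nonneg

lemma Matrix.PosSemidef.mul_eq_zero_of_trace_le {A B : Matrix n n ℂ} (hA : A.PosSemidef)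
    (hB : B.PosSemidef) (h : (A * B).trace.re ≤ 0) : A * B = 0 := by
  have h0 := hA.trace_mul_nonneg hB
  have htr : (A * B).trace = 0 :=
    Complex.ext (le_antisymm h (Complex.le_def.mp h0).1) (Complex.le_def.mp h0).2.symm
  obtain ⟨C, rfl⟩ := hA.exists_eq_conjTranspose_mul_self_s13
  obtain ⟨E, rfl⟩ := hB.exists_eq_conjTranspose_mul_self_s13
  have hCE : C * Eᴴ = 0 := by
    rw [← trace_mul_conjTranspose_self_eq_zero_iff, ← htr, conjTranspose_mul,
      conjTranspose_conjTranspose, trace_mul_comm]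
    simp only [mul_assoc]
    rw [trace_mul_comm]
    simp only [mul_assoc]
  calc Cᴴ * C * (Eᴴ * E) = Cᴴ * (C * Eᴴ) * E := by simp only [mul_assoc]
    _ = 0 := by simp [hCE]

lemma Matrix.PosDef.log_det_le_trace_sub_card {X : Matrix n n ℂ} (hX : X.PosDef) :
    Real.log X.det.re ≤ X.trace.re - Fintype.card n := by
  have hdet : X.det.re = ∏ i, hX.1.eigenvalues i := by
    rw [hX.1.det_eq_prod_eigenvalues]
    norm_cast
  have htr : X.trace.re = ∑ i, hX.1.eigenvalues i := by
    rw [hX.1.trace_eq_sum_eigenvalues]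
    norm_cast
  rw [hdet, htr, Real.log_prod fun i _ => (hX.eigenvalues_pos i).ne']
  calc ∑ i, Real.log (hX.1.eigenvalues i) ≤ ∑ i, (hX.1.eigenvalues i - 1) :=
        Finset.sum_le_sum fun i _ => Real.log_le_sub_one_of_pos (hX.eigenvalues_pos i)
    _ = _ := by simp

lemma Matrix.PosDef.det_re_pos {X : Matrix n n ℂ} (hX : X.PosDef) : 0 < X.det.re :=
  (Complex.lt_def.mp hX.det_pos).1

lemma Matrix.PosDef.det_eq_re {X : Matrix n n ℂ} (hX : X.PosDef) : X.det = (X.det.re : ℂ) :=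
  Complex.ext rfl (Complex.lt_def.mp hX.det_pos).2.symm

/-- The first-order upper bound for the concave function `log det`. -/
lemma Matrix.PosDef.log_det_sub_log_det_le {X Y : Matrix n n ℂ} (hX : X.PosDef) (hY : Y.PosDef) :
    Real.log X.det.re - Real.log Y.det.re ≤ (Y⁻¹ * (X - Y)).trace.re := by
  obtain ⟨C, hC⟩ := hY.inv.posSemidef.exists_eq_conjTranspose_mul_self_s13
  have hdetC : C.det ≠ 0 := fun h => hY.inv.det_pos.ne' (by rw [hC, det_mul, h, mul_zero])
  have hpd : (C * X * Cᴴ).PosDef := by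
    refine hX.mul_mul_conjTranspose_same ?_
    exact vecMul_injective_of_isUnit ((isUnit_iff_isUnit_det C).mpr hdetC.isUnit)
  have hdet : (C * X * Cᴴ).det.re = X.det.re / Y.det.re := by
    have h1 : (C * X * Cᴴ).det = X.det * (Y⁻¹).det := by
      rw [hC, det_mul, det_mul, det_mul]; ring
    rw [h1, det_nonsing_inv, Ring.inverse_eq_inv', hX.det_eq_re, hY.det_eq_re]
    norm_cast
  have htr : (C * X * Cᴴ).trace = (Y⁻¹ * (X - Y)).trace + Fintype.card n := by
    rw [mul_sub, nonsing_inv_mul _ ((isUnit_iff_isUnit_det Y).mp hY.isUnit), trace_sub, trace_one,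
      sub_add_cancel, trace_mul_comm, ← mul_assoc, hC]
  have := hpd.log_det_le_trace_sub_card
  rw [hdet, htr, Real.log_div hX.det_re_pos.ne' hY.det_re_pos.ne'] at this
  simpa using this

/-- `log det (1 + W K)`. -/
noncomputable def logDetOneAdd (W K : Matrix n n ℂ) : ℝ := Real.log (1 + W * K).det.re

lemma Matrix.PosSemidef.exists_posDef_det_one_add_mul {W K : Matrix n n ℂ} (hW : W.PosSemidef)
    (hK : K.PosSemidef) : ∃ X : Matrix n n ℂ, X.PosDef ∧ (1 + W * K).det = X.det := by
  obtain ⟨B, rfl⟩ := hW.exists_eq_conjTranspose_mul_self_s13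
  refine ⟨1 + B * K * Bᴴ, PosDef.one.add_posSemidef (hK.mul_mul_conjTranspose_same B), ?_⟩
  rw [mul_assoc, det_one_add_mul_comm]

lemma Matrix.PosSemidef.det_one_add_mul_re_pos {W K : Matrix n n ℂ} (hW : W.PosSemidef)
    (hK : K.PosSemidef) : 0 < (1 + W * K).det.re := by
  obtain ⟨X, hX, h⟩ := hW.exists_posDef_det_one_add_mul hK
  exact h ▸ hX.det_re_pos

lemma Matrix.PosSemidef.isUnit_det_one_add_mul {W K : Matrix n n ℂ} (hW : W.PosSemidef)
    (hK : K.PosSemidef) : IsUnit (1 + W * K).det := by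
  obtain ⟨X, hX, h⟩ := hW.exists_posDef_det_one_add_mul hK
  exact h ▸ (isUnit_iff_isUnit_det X).mp hX.isUnit

lemma logDetOneAdd_comm (W K : Matrix n n ℂ) : logDetOneAdd W K = logDetOneAdd K W := by
  rw [logDetOneAdd, det_one_add_mul_comm, logDetOneAdd]

lemma mul_inv_one_add_mul {W K : Matrix n n ℂ} (hW : W.PosSemidef) (hK : K.PosSemidef) :
    W * (1 + K * W)⁻¹ = (1 + W * K)⁻¹ * W := by
  have h1 := mul_nonsing_inv _ (hK.isUnit_det_one_add_mul hW)
  have h2 := nonsing_inv_mul _ (hW.isUnit_det_one_add_mul hK)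
  linear_combination (norm := noncomm_ring) (1 + W * K)⁻¹ * W * h1 - h2 * W * (1 + K * W)⁻¹

lemma Matrix.PosSemidef.mul_inv_one_add_mul {W K : Matrix n n ℂ} (hW : W.PosSemidef)
    (hK : K.PosSemidef) : (W * (1 + K * W)⁻¹).PosSemidef := by
  set S := (1 + K * W)⁻¹
  have h1 : (1 + K * W) * S = 1 := mul_nonsing_inv _ (hK.isUnit_det_one_add_mul hW)
  have h1' : Sᴴ * (1 + W * K) = 1 := by
    have := congrArg (fun X => Xᴴ) h1
    simpa [hW.1.eq, hK.1.eq] using this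
  have : W * S = Sᴴ * W * S + (W * S)ᴴ * K * (W * S) := by
    rw [conjTranspose_mul, hW.1.eq]
    linear_combination (norm := noncomm_ring) -h1' * W * S
  rw [this]
  exact (hW.conjTranspose_mul_mul_same S).add (hK.conjTranspose_mul_mul_same (W * S))

/-- The first-order upper bound, in the covariance matrix, for the rate of a degraded channel. -/
lemma logDetOneAdd_sub_le {W₁ W₂ K K₀ : Matrix n n ℂ} (hW₂ : W₂.PosSemidef)
    (hW : (W₁ - W₂).PosSemidef) (hK : K.PosSemidef) (hK₀ : K₀.PosSemidef) :
    logDetOneAdd W₁ K - logDetOneAdd W₂ K - (logDetOneAdd W₁ K₀ - logDetOneAdd W₂ K₀) ≤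
      ((W₁ * (1 + K₀ * W₁)⁻¹ - W₂ * (1 + K₀ * W₂)⁻¹) * (K - K₀)).trace.re := by
  have hW₁ : W₁.PosSemidef := by simpa using hW.add hW₂
  obtain ⟨B, hB⟩ := hW.exists_eq_conjTranspose_mul_self_s13
  have key : ∀ L : Matrix n n ℂ, L.PosSemidef →
      (1 + B * (L * (1 + W₂ * L)⁻¹) * Bᴴ).PosDef ∧ logDetOneAdd W₁ L - logDetOneAdd W₂ L =
        Real.log (1 + B * (L * (1 + W₂ * L)⁻¹) * Bᴴ).det.re := by
    intro L hL
    have hX : (1 + B * (L * (1 + W₂ * L)⁻¹) * Bᴴ).PosDef :=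
      PosDef.one.add_posSemidef ((hL.mul_inv_one_add_mul hW₂).mul_mul_conjTranspose_same B)
    refine ⟨hX, ?_⟩
    obtain ⟨Y, hY, hYdet⟩ := hW₂.exists_posDef_det_one_add_mul hL
    have h1 := nonsing_inv_mul _ (hW₂.isUnit_det_one_add_mul hL)
    have h2 : (1 + W₁ * L).det = (1 + B * (L * (1 + W₂ * L)⁻¹) * Bᴴ).det * (1 + W₂ * L).det := by
      rw [mul_assoc B, det_one_add_mul_comm B, mul_assoc _ Bᴴ, ← hB,
        det_one_add_mul_comm _ (W₁ - W₂), ← det_mul]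
      congr 1
      linear_combination (norm := noncomm_ring) (W₂ - W₁) * L * h1
    rw [logDetOneAdd, logDetOneAdd, h2, hYdet, hX.det_eq_re, hY.det_eq_re, ← Complex.ofReal_mul,
      Complex.ofReal_re, Complex.ofReal_re,
      Real.log_mul hX.det_re_pos.ne' hY.det_re_pos.ne', add_sub_cancel_right, Complex.ofReal_re]
  obtain ⟨hX, hXeq⟩ := key K hK
  obtain ⟨hX₀, hX₀eq⟩ := key K₀ hK₀
  rw [hXeq, hX₀eq]
  refine (hX.log_det_sub_log_det_le hX₀).trans ?_
  rw [mul_inv_one_add_mul hK hW₂] at hX ⊢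
  set X₀ := 1 + B * (K₀ * (1 + W₂ * K₀)⁻¹) * Bᴴ with hX₀def
  rw [mul_inv_one_add_mul hW₁ hK₀]
  set R := (1 + W₂ * K₀)⁻¹
  set S := (1 + K₀ * W₂)⁻¹
  set SK := (1 + K * W₂)⁻¹
  set Y := (1 + W₁ * K₀)⁻¹
  have hR : (1 + W₂ * K₀) * R = 1 := mul_nonsing_inv _ (hW₂.isUnit_det_one_add_mul hK₀)
  have hS : (1 + K₀ * W₂) * S = 1 := mul_nonsing_inv _ (hK₀.isUnit_det_one_add_mul hW₂)
  have hS' : S * (1 + K₀ * W₂) = 1 := nonsing_inv_mul _ (hK₀.isUnit_det_one_add_mul hW₂)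
  have hSK₁ : (1 + K * W₂) * SK = 1 := mul_nonsing_inv _ (hK.isUnit_det_one_add_mul hW₂)
  have hSK₂ : SK * (1 + K * W₂) = 1 := nonsing_inv_mul _ (hK.isUnit_det_one_add_mul hW₂)
  have hY : Y * (1 + W₁ * K₀) = 1 := nonsing_inv_mul _ (hW₁.isUnit_det_one_add_mul hK₀)
  have hZ : X₀ * X₀⁻¹ = 1 := mul_nonsing_inv _ ((isUnit_iff_isUnit_det _).mp hX₀.isUnit)
  have hRS : R = Sᴴ := by
    simp [R, S, conjTranspose_nonsing_inv, hW₂.1.eq, hK₀.1.eq]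
  have hgrad : R * Bᴴ * X₀⁻¹ * B * S = Y * W₁ - W₂ * S := by
    have h3 : (1 + W₁ * K₀) * R * Bᴴ = Bᴴ * X₀ := by
      rw [hX₀def]
      linear_combination (norm := noncomm_ring) hR * Bᴴ + hB * K₀ * R * Bᴴ
    have h4 : R * Bᴴ * X₀⁻¹ = Y * Bᴴ := by
      linear_combination (norm := noncomm_ring)
        Y * h3 * X₀⁻¹ + Y * Bᴴ * hZ - hY * R * Bᴴ * X₀⁻¹
    rw [h4]
    linear_combination (norm := noncomm_ring) Y * W₁ * hS - Y * hB * S - hY * W₂ * S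
  have hconc : K₀ * R + S * (K - K₀) * R - SK * K =
      S * ((K - K₀) * (W₂ * SK) * (K - K₀)ᴴ) * Sᴴ := by
    have h5 : SK * K - K₀ * R = SK * (K - K₀) * R := by
      linear_combination (norm := noncomm_ring) hSK₂ * K₀ * R - SK * K * hR
    have h6 : S - SK = S * (K - K₀) * W₂ * SK := by
      linear_combination (norm := noncomm_ring) hS' * SK - S * hSK₁
    rw [conjTranspose_sub, hK.1.eq, hK₀.1.eq, ← hRS]
    linear_combination (norm := noncomm_ring) h6 * (K - K₀) * R - h5
  have hpsd : (B * (K₀ * R + S * (K - K₀) * R - SK * K) * Bᴴ).PosSemidef := by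
    rw [hconc]
    exact (((hW₂.mul_inv_one_add_mul hK).mul_mul_conjTranspose_same
      (K - K₀)).mul_mul_conjTranspose_same S).mul_mul_conjTranspose_same B
  have hnn := (Complex.le_def.mp (hX₀.inv.posSemidef.trace_mul_nonneg hpsd)).1
  have hsum : (X₀⁻¹ * (B * (K₀ * R + S * (K - K₀) * R - SK * K) * Bᴴ)).trace +
      (X₀⁻¹ * (1 + B * (SK * K) * Bᴴ - X₀)).trace =
      ((Y * W₁ - W₂ * S) * (K - K₀)).trace := by
    rw [← hgrad, ← trace_add, trace_mul_comm _ (K - K₀)]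
    calc _ = (X₀⁻¹ * B * S * (K - K₀) * (R * Bᴴ)).trace := by
          congr 1
          rw [hX₀def]
          noncomm_ring
      _ = _ := by
        rw [trace_mul_comm, ← mul_assoc, trace_mul_comm]
        simp only [mul_assoc]
  rw [← hsum, Complex.add_re]
  simpa using hnn

/-- The first-order upper bound for the rate of a single Gaussian channel. -/
lemma logDetOneAdd_sub_le_trace {W K K₀ : Matrix n n ℂ} (hW : W.PosSemidef)
    (hK : K.PosSemidef) (hK₀ : K₀.PosSemidef) :
    logDetOneAdd W K - logDetOneAdd W K₀ ≤ (W * (1 + K₀ * W)⁻¹ * (K - K₀)).trace.re := by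
  have := logDetOneAdd_sub_le (W₁ := W) PosSemidef.zero (by simpa using hW) hK hK₀
  simpa [logDetOneAdd] using this

lemma logDetOneAdd_mono {W₁ W₂ K : Matrix n n ℂ} (hW₂ : W₂.PosSemidef)
    (hW : (W₁ - W₂).PosSemidef) (hK : K.PosSemidef) : logDetOneAdd W₂ K ≤ logDetOneAdd W₁ K := by
  have hW₁ : W₁.PosSemidef := by simpa using hW.add hW₂
  have h := logDetOneAdd_sub_le_trace hK hW₂ hW₁
  have hnn := (Complex.le_def.mp ((hK.mul_inv_one_add_mul hW₁).trace_mul_nonneg hW)).1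
  rw [← neg_sub W₁, mul_neg, trace_neg, Complex.neg_re] at h
  simp only [Complex.zero_re] at hnn
  rw [logDetOneAdd_comm W₁, logDetOneAdd_comm W₂]
  linarith

lemma logDetOneAdd_add_le {W U K : Matrix n n ℂ} (hW : W.PosSemidef) (hU : U.PosSemidef)
    (hK : K.PosSemidef) : logDetOneAdd (W + U) K ≤ logDetOneAdd W K + (K * U).trace.re := by
  have h := logDetOneAdd_sub_le_trace hK (hW.add hU) hW
  have hpsd : (K - K * (1 + W * K)⁻¹).PosSemidef := by
    have : K - K * (1 + W * K)⁻¹ = Kᴴ * (W * (1 + K * W)⁻¹) * K := by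
      rw [hK.1.eq, mul_inv_one_add_mul hW hK]
      have h2 := nonsing_inv_mul _ (hW.isUnit_det_one_add_mul hK)
      linear_combination (norm := noncomm_ring) -K * h2
    rw [this]
    exact (hW.mul_inv_one_add_mul hK).conjTranspose_mul_mul_same K
  have hnn := (Complex.le_def.mp (hpsd.trace_mul_nonneg hU)).1
  rw [sub_mul, trace_sub, Complex.sub_re, Complex.zero_re] at hnn
  rw [add_sub_cancel_left] at h
  rw [logDetOneAdd_comm _ K, logDetOneAdd_comm _ K]
  linarith

lemma continuousAt_matrix_inv_of_isUnit {A : Matrix n n ℂ} (hA : IsUnit A.det) :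
    ContinuousAt (fun X : Matrix n n ℂ => X⁻¹) A := by
  refine continuousAt_matrix_inv A ?_
  rw [Ring.inverse_eq_inv']
  exact continuousAt_inv₀ hA.ne_zero

/-- The first-order optimality condition for a maximizer of the secrecy rate on a segment. -/
lemma trace_gradient_mul_sub_nonpos {W₁ W₂ K K₀ : Matrix n n ℂ} (hW₁ : W₁.PosSemidef)
    (hW₂ : W₂.PosSemidef) (hK : K.PosSemidef) (hK₀ : K₀.PosSemidef)
    (hmax : ∀ t : ℝ, 0 < t → t ≤ 1 →
      logDetOneAdd W₁ (K₀ + (t : ℂ) • (K - K₀)) - logDetOneAdd W₂ (K₀ + (t : ℂ) • (K - K₀)) ≤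
        logDetOneAdd W₁ K₀ - logDetOneAdd W₂ K₀) :
    ((W₁ * (1 + K₀ * W₁)⁻¹ - W₂ * (1 + K₀ * W₂)⁻¹) * (K - K₀)).trace.re ≤ 0 := by
  rw [sub_mul, trace_sub, Complex.sub_re, sub_nonpos]
  have hcont : ContinuousAt (fun t : ℝ =>
      (W₁ * (1 + (K₀ + (t : ℂ) • (K - K₀)) * W₁)⁻¹ * (K - K₀)).trace.re) 0 := by
    have h1 : Continuous fun t : ℝ => 1 + (K₀ + (t : ℂ) • (K - K₀)) * W₁ := by fun_prop
    have h2 : ContinuousAt (fun t : ℝ => (1 + (K₀ + (t : ℂ) • (K - K₀)) * W₁)⁻¹) 0 := by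
      refine ContinuousAt.comp (f := fun t : ℝ => 1 + (K₀ + (t : ℂ) • (K - K₀)) * W₁)
        (g := fun X => X⁻¹) (continuousAt_matrix_inv_of_isUnit ?_) h1.continuousAt
      simpa using hK₀.isUnit_det_one_add_mul hW₁
    have h3 : Continuous fun X : Matrix n n ℂ => (W₁ * X * (K - K₀)).trace.re :=
      Complex.continuous_re.comp (Continuous.matrix_trace (by fun_prop))
    exact h3.continuousAt.comp h2
  have hlim := hcont.tendsto.mono_left (nhdsWithin_le_nhds (s := Set.Ioi 0))
  simp only [Complex.ofReal_zero, zero_smul, add_zero] at hlim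
  refine le_of_tendsto hlim ?_
  filter_upwards [Ioc_mem_nhdsGT (zero_lt_one' ℝ)] with t ht
  have hKt : (K₀ + (t : ℂ) • (K - K₀)).PosSemidef := by
    have : K₀ + (t : ℂ) • (K - K₀) = ((1 - t : ℝ) : ℂ) • K₀ + (t : ℂ) • K := by
      push_cast; module
    rw [this]
    exact (hK₀.smul (Complex.zero_le_real.mpr (sub_nonneg.mpr ht.2))).add
      (hK.smul (Complex.zero_le_real.mpr ht.1.le))
  have h1 := logDetOneAdd_sub_le_trace hW₁ hK₀ hKt
  have h2 := logDetOneAdd_sub_le_trace hW₂ hKt hK₀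
  have h3 := hmax t ht.1 ht.2
  simp only [sub_add_cancel_left, add_sub_cancel_left, mul_neg, mul_smul_comm, trace_neg,
    trace_smul, Complex.neg_re, smul_eq_mul, Complex.re_ofReal_mul] at h1 h2
  nlinarith [ht.1]

/-- Channel enhancement: the first-order optimality condition for `K₀` under a trace constraint
yields an enhanced legitimate channel with Gram matrix `W₁ + M`, of which the eavesdropper is
degraded, and whose secrecy rate is maximized at `K₀` with the same value. -/
lemma exists_enhanced_channel {W₁ W₂ K₀ : Matrix n n ℂ} {P : ℝ} (hP : 0 < P)
    (hW₁ : W₁.PosSemidef) (hW₂ : W₂.PosSemidef) (hK₀ : K₀.PosSemidef) (htr : K₀.trace.re ≤ P)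
    (hopt : ∀ K : Matrix n n ℂ, K.PosSemidef → K.trace.re ≤ P →
      ((W₁ * (1 + K₀ * W₁)⁻¹ - W₂ * (1 + K₀ * W₂)⁻¹) * (K - K₀)).trace.re ≤ 0) :
    ∃ (c : ℝ) (M : Matrix n n ℂ),
      M = (c : ℂ) • 1 - (W₁ * (1 + K₀ * W₁)⁻¹ - W₂ * (1 + K₀ * W₂)⁻¹) ∧
      M.PosSemidef ∧ (W₁ + M - W₂).PosSemidef ∧
      ∀ K : Matrix n n ℂ, K.PosSemidef → K.trace.re ≤ P →
        logDetOneAdd (W₁ + M) K - logDetOneAdd W₂ K ≤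
          logDetOneAdd W₁ K₀ - logDetOneAdd W₂ K₀ := by
  have hG₁ := hW₁.mul_inv_one_add_mul hK₀
  have hG₂ := hW₂.mul_inv_one_add_mul hK₀
  have hG₁r := mul_inv_one_add_mul hW₁ hK₀
  have hG₂r := mul_inv_one_add_mul hW₂ hK₀
  have hT₁ := nonsing_inv_mul _ (hK₀.isUnit_det_one_add_mul hW₁)
  have hR₁ := nonsing_inv_mul _ (hW₁.isUnit_det_one_add_mul hK₀)
  have hR₁' := mul_nonsing_inv _ (hW₁.isUnit_det_one_add_mul hK₀)
  have hR₂' := mul_nonsing_inv _ (hW₂.isUnit_det_one_add_mul hK₀)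
  set G₁ := W₁ * (1 + K₀ * W₁)⁻¹ with hG₁def
  set G₂ := W₂ * (1 + K₀ * W₂)⁻¹
  set c : ℝ := ((G₁ - G₂) * K₀).trace.re / P with hc
  have hcP : ((G₁ - G₂) * K₀).trace.re = c * P := by rw [hc, div_mul_cancel₀ _ hP.ne']
  have hlin : ∀ K : Matrix n n ℂ, K.PosSemidef → K.trace.re ≤ P →
      ((G₁ - G₂) * K).trace.re ≤ c * P := by
    intro K hK hKP
    have := hopt K hK hKP
    rw [mul_sub, trace_sub, Complex.sub_re, hcP] at this
    linarith
  have hc0 : 0 ≤ c := by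
    have := hlin 0 PosSemidef.zero (by simpa using hP.le)
    simp only [mul_zero, trace_zero, Complex.zero_re] at this
    exact nonneg_of_mul_nonneg_left this hP
  have hcC : (0 : ℂ) ≤ c := Complex.zero_le_real.mpr hc0
  set M : Matrix n n ℂ := (c : ℂ) • 1 - (G₁ - G₂) with hMdef
  have hMherm : M.IsHermitian := by
    have h1 : ((c : ℂ) • (1 : Matrix n n ℂ)).IsHermitian := (PosSemidef.one.smul hcC).1
    exact h1.sub (hG₁.1.sub hG₂.1)
  have hM : M.PosSemidef := by
    refine .of_dotProduct_mulVec_nonneg hMherm fun x => ?_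
    have him : (star x ⬝ᵥ (M *ᵥ x)).im = 0 := hMherm.im_star_dotProduct_mulVec_self x
    refine Complex.le_def.mpr ⟨?_, him.symm⟩
    rcases eq_or_ne x 0 with rfl | hx
    · simp
    have hs : 0 < (star x ⬝ᵥ x).re := (Complex.lt_def.mp (dotProduct_star_self_pos_iff.mpr hx)).1
    have hv : (vecMulVec x (star x)).PosSemidef := posSemidef_vecMulVec_self_star x
    have htrv : ∀ A : Matrix n n ℂ, (A * vecMulVec x (star x)).trace = star x ⬝ᵥ (A *ᵥ x) := by
      intro A
      rw [mul_vecMulVec, trace_vecMulVec, dotProduct_comm]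
    have h1 := hlin (((P / (star x ⬝ᵥ x).re : ℝ) : ℂ) • vecMulVec x (star x))
      (hv.smul (Complex.zero_le_real.mpr (by positivity))) (by
        rw [trace_smul, trace_vecMulVec, dotProduct_comm x, smul_eq_mul, Complex.re_ofReal_mul,
          div_mul_cancel₀ _ hs.ne'])
    rw [mul_smul_comm, trace_smul, htrv, smul_eq_mul, Complex.re_ofReal_mul, div_mul_eq_mul_div,
      div_le_iff₀ hs] at h1
    rw [hMdef, sub_mulVec, dotProduct_sub, Complex.sub_re, smul_mulVec, one_mulVec,
      dotProduct_smul, smul_eq_mul, Complex.re_ofReal_mul, Complex.zero_re, sub_nonneg]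
    have : P * (star x ⬝ᵥ ((G₁ - G₂) *ᵥ x)).re ≤ P * (c * (star x ⬝ᵥ x).re) := by linarith
    exact le_of_mul_le_mul_left this hP
  have htrM : (M * K₀).trace.re = c * K₀.trace.re - c * P := by
    rw [hMdef, sub_mul, trace_sub, Complex.sub_re, hcP, smul_mul_assoc, one_mul, trace_smul,
      smul_eq_mul, Complex.re_ofReal_mul]
  have hMK : M * K₀ = 0 := hM.mul_eq_zero_of_trace_le hK₀ (by
    rw [htrM]; nlinarith)
  have hKM : K₀ * M = 0 := by
    have := congrArg (fun X => Xᴴ) hMK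
    simpa [hM.1.eq, hK₀.1.eq] using this
  have hctr : c * K₀.trace.re = c * P := by
    rw [hMK] at htrM
    simp only [trace_zero, Complex.zero_re] at htrM
    linarith
  have hone : 1 + K₀ * (W₁ + M) = 1 + K₀ * W₁ := by rw [mul_add, hKM, add_zero]
  have hGt : (W₁ + M) * (1 + K₀ * W₁)⁻¹ - G₂ = (c : ℂ) • 1 := by
    have h1 : M * (1 + K₀ * W₁)⁻¹ = M := by
      have hT₁' := mul_nonsing_inv _ (hK₀.isUnit_det_one_add_mul hW₁)
      linear_combination (norm := noncomm_ring) M * hT₁' - hMK * W₁ * (1 + K₀ * W₁)⁻¹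
    rw [add_mul, h1, ← hG₁def, hMdef]
    abel
  have hdeg : (W₁ + M - W₂).PosSemidef := by
    have hmid : (K₀ - K₀ * (G₁ + M) * K₀).PosSemidef := by
      have : K₀ - K₀ * (G₁ + M) * K₀ = K₀ * (1 + W₁ * K₀)⁻¹ := by
        rw [hG₁r]
        linear_combination (norm := noncomm_ring) -K₀ * hMK - K₀ * hR₁
      rw [this]
      exact hK₀.mul_inv_one_add_mul hW₁
    have e : G₁ + M - G₂ = (c : ℂ) • 1 := by rw [hMdef]; abel
    have e1 : (G₁ + M) * (1 + K₀ * (W₁ + M)) = W₁ + M := by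
      rw [hone, hG₁def]
      linear_combination (norm := noncomm_ring) W₁ * hT₁ + hMK * W₁
    have e2 : (1 + (W₁ + M) * K₀) * (G₁ + M) = W₁ + M := by
      rw [hG₁r]
      linear_combination (norm := noncomm_ring) hR₁' * W₁ + hMK * (1 + W₁ * K₀)⁻¹ * W₁
        + hMK * M + W₁ * hKM
    have e3 : (1 + W₂ * K₀) * G₂ = W₂ := by
      rw [hG₂r]
      linear_combination (norm := noncomm_ring) hR₂' * W₂
    have hsplit : W₁ + M - W₂ = (1 + W₂ * K₀) * ((c : ℂ) • (1 : Matrix n n ℂ)) * (1 + W₂ * K₀)ᴴ +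
        (W₂ - (W₁ + M)) * (K₀ - K₀ * (G₁ + M) * K₀) * (W₂ - (W₁ + M))ᴴ := by
      rw [conjTranspose_add, conjTranspose_one, conjTranspose_mul, conjTranspose_sub,
        conjTranspose_add, hW₁.1.eq, hW₂.1.eq, hK₀.1.eq, hM.1.eq]
      generalize W₁ + M = Wt at e1 e2 ⊢
      generalize G₁ + M = Gt at e e1 e2 ⊢
      linear_combination (norm := noncomm_ring) (1 + W₂ * K₀) * e * (1 + K₀ * W₂) +
        e3 * (1 + K₀ * W₂) - e2 * K₀ * (W₂ - Wt) - e1 - W₂ * K₀ * e1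
    rw [hsplit]
    exact ((PosSemidef.one.smul hcC).mul_mul_conjTranspose_same _).add
      (hmid.mul_mul_conjTranspose_same _)
  refine ⟨c, M, rfl, hM, hdeg, fun K hK hKP => ?_⟩
  have h := logDetOneAdd_sub_le hW₂ hdeg hK hK₀
  have hK₀eq : logDetOneAdd (W₁ + M) K₀ = logDetOneAdd W₁ K₀ := by
    rw [logDetOneAdd, add_mul, hMK, add_zero, logDetOneAdd]
  rw [hone, hGt, hK₀eq, smul_mul_assoc, one_mul, trace_smul, trace_sub, smul_eq_mul,
    Complex.re_ofReal_mul, Complex.sub_re, mul_sub, hctr] at h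
  have := mul_le_mul_of_nonneg_left hKP hc0
  linarith

end LogDet

section NoiseCorrelation

variable {m n k : Type*} [Fintype m] [DecidableEq m] [Fintype n]
  [Fintype k] [DecidableEq k]

lemma posSemidef_one_sub_mul_inv_mul [DecidableEq n] {Y : Matrix m n ℂ} {Z : Matrix n n ℂ} (hZ : Z.PosDef)
    (h : (Z - Yᴴ * Y).PosSemidef) : (1 - Y * Z⁻¹ * Yᴴ).PosSemidef := by
  have := hZ.isUnit.invertible
  have : Invertible (1 : Matrix m m ℂ) := invertibleOne
  rw [← PosDef.fromBlocks₂₂ _ _ hZ, PosDef.fromBlocks₁₁ _ _ PosDef.one]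
  simpa using h

/-- If two channels are degraded with respect to the Gram matrix `Z`, some noise correlation makes
the joint channel degraded with respect to `c⁻¹ Z`, for any `0 < c < 1`. -/
lemma posDef_noiseCorrelation [DecidableEq n] {Y₁ : Matrix m n ℂ} {Y₂ : Matrix k n ℂ}
    {Z : Matrix n n ℂ}
    (hZ : Z.PosDef) (h₁ : (Z - Y₁ᴴ * Y₁).PosSemidef) (h₂ : (Z - Y₂ᴴ * Y₂).PosSemidef) {c : ℝ}
    (hc0 : 0 < c) (hc1 : c < 1) {Q : Matrix (m ⊕ k) (m ⊕ k) ℂ}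
    (hQ : Q = fromBlocks 1 ((c : ℂ) • (Y₁ * Z⁻¹ * Y₂ᴴ)) ((c : ℂ) • (Y₁ * Z⁻¹ * Y₂ᴴ))ᴴ 1) :
    Q.PosDef ∧
      (((c⁻¹ : ℝ) : ℂ) • Z - (fromRows Y₁ Y₂)ᴴ * Q⁻¹ * fromRows Y₁ Y₂).PosSemidef := by
  have hcC : (0 : ℂ) < c := Complex.zero_lt_real.mpr hc0
  have hdiag : ∀ (A : Matrix m m ℂ) (D : Matrix k k ℂ), A.PosSemidef → D.PosSemidef →
      (fromBlocks A 0 0 D).PosSemidef := by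
    intro A D hA hD
    obtain ⟨B, rfl⟩ := hA.exists_eq_conjTranspose_mul_self_s13
    obtain ⟨C, rfl⟩ := hD.exists_eq_conjTranspose_mul_self_s13
    have := posSemidef_conjTranspose_mul_self (fromBlocks B 0 0 C)
    simpa [fromBlocks_conjTranspose, fromBlocks_multiply] using this
  have hZi : Z⁻¹ᴴ = Z⁻¹ := hZ.inv.1
  have hsum : Q - ((c : ℂ) • (fromRows Y₁ Y₂ * Z⁻¹ * (fromRows Y₁ Y₂)ᴴ)) =
      ((1 - c : ℝ) : ℂ) • (1 : Matrix (m ⊕ k) (m ⊕ k) ℂ) + (c : ℂ) •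
        fromBlocks (1 - Y₁ * Z⁻¹ * Y₁ᴴ) 0 0 (1 - Y₂ * Z⁻¹ * Y₂ᴴ) := by
    rw [sub_eq_iff_eq_add, hQ, fromRows_mul, conjTranspose_fromRows_eq_fromCols_conjTranspose,
      fromRows_mul_fromCols, ← fromBlocks_one]
    simp only [fromBlocks_smul, fromBlocks_add, conjTranspose_smul, conjTranspose_mul,
      conjTranspose_conjTranspose, hZi, Complex.star_def, Complex.conj_ofReal, Matrix.mul_assoc]
    push_cast
    congr 1 <;> module
  have hdef : (((1 - c : ℝ) : ℂ) • (1 : Matrix (m ⊕ k) (m ⊕ k) ℂ) + (c : ℂ) •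
        fromBlocks (1 - Y₁ * Z⁻¹ * Y₁ᴴ) 0 0 (1 - Y₂ * Z⁻¹ * Y₂ᴴ)).PosDef :=
    (PosDef.one.smul (Complex.zero_lt_real.mpr (sub_pos.mpr hc1))).add_posSemidef
      ((hdiag _ _ (posSemidef_one_sub_mul_inv_mul hZ h₁)
        (posSemidef_one_sub_mul_inv_mul hZ h₂)).smul hcC.le)
  have hQpd : Q.PosDef := by
    rw [← sub_add_cancel Q ((c : ℂ) • (fromRows Y₁ Y₂ * Z⁻¹ * (fromRows Y₁ Y₂)ᴴ)), hsum]
    exact hdef.add_posSemidef ((hZ.inv.posSemidef.mul_mul_conjTranspose_same _).smul hcC.le)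
  refine ⟨hQpd, ?_⟩
  have hcZ : (((c⁻¹ : ℝ) : ℂ) • Z).PosDef :=
    hZ.smul (Complex.zero_lt_real.mpr (inv_pos.mpr hc0))
  have := hcZ.isUnit.invertible
  have := hQpd.isUnit.invertible
  have hinv : (((c⁻¹ : ℝ) : ℂ) • Z)⁻¹ = (c : ℂ) • Z⁻¹ := by
    refine inv_eq_left_inv ?_
    rw [smul_mul_smul_comm, nonsing_inv_mul _ ((isUnit_iff_isUnit_det Z).mp hZ.isUnit),
      ← Complex.ofReal_mul, mul_inv_cancel₀ hc0.ne', Complex.ofReal_one, one_smul]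
  rw [← PosDef.fromBlocks₁₁ _ _ hQpd, PosDef.fromBlocks₂₂ _ _ hcZ, hinv,
    Matrix.mul_smul, Matrix.smul_mul, hsum]
  exact hdef.posSemidef

/-- Observing both channel outputs is at least as informative as observing the first alone. -/
lemma posSemidef_joint_sub_first {Y₁ : Matrix m n ℂ} {Y₂ : Matrix k n ℂ} {A : Matrix m k ℂ}
    {D : Matrix k k ℂ} (hQ : (fromBlocks 1 A Aᴴ D).PosDef) :
    ((fromRows Y₁ Y₂)ᴴ * (fromBlocks 1 A Aᴴ D)⁻¹ * fromRows Y₁ Y₂ - Y₁ᴴ * Y₁).PosSemidef := by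
  set Q := fromBlocks 1 A Aᴴ D with hQdef
  let E : Matrix (m ⊕ k) m ℂ := fromRows 1 0
  have := hQ.isUnit.invertible
  have := hQ.inv.isUnit.invertible
  have : Invertible (1 : Matrix m m ℂ) := invertibleOne
  have hE : (Q⁻¹ - E * Eᴴ).PosSemidef := by
    have h1 : (Q⁻¹ - E * (1 : Matrix m m ℂ)⁻¹ * Eᴴ).PosSemidef := by
      rw [← PosDef.fromBlocks₂₂ _ _ PosDef.one, PosDef.fromBlocks₁₁ _ _ hQ.inv, inv_inv_of_invertible]
      have : Eᴴ * Q * E = 1 := by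
        simp [E, hQdef, conjTranspose_fromRows_eq_fromCols_conjTranspose,
          fromCols_mul_fromBlocks, fromCols_mul_fromRows]
      rw [this, sub_self]
      exact PosSemidef.zero
    simpa using h1
  have hEY : Eᴴ * fromRows Y₁ Y₂ = Y₁ := by
    simp [E, conjTranspose_fromRows_eq_fromCols_conjTranspose, fromCols_mul_fromRows]
  have := hE.conjTranspose_mul_mul_same (fromRows Y₁ Y₂)
  rw [Matrix.mul_sub, Matrix.sub_mul, ← Matrix.mul_assoc _ E, Matrix.mul_assoc (_ * E), hEY] at this
  convert this using 3
  rw [← conjTranspose_conjTranspose E, ← conjTranspose_mul, hEY]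

end NoiseCorrelation

section AugConj

variable {m n k : Type*}

/-- Conjugation and exchange of the two halves of an augmented matrix; its fixed points are the
matrices of the form `[[A, B], [B*, A*]]`. -/
def augConj (M : Matrix (m ⊕ m) (n ⊕ n) ℂ) : Matrix (m ⊕ m) (n ⊕ n) ℂ :=
  mconj (M.submatrix (Equiv.sumComm m m) (Equiv.sumComm n n))

lemma augConj_mul [Fintype n] (M : Matrix (m ⊕ m) (n ⊕ n) ℂ) (N : Matrix (n ⊕ n) (k ⊕ k) ℂ) :
    augConj (M * N) = augConj M * augConj N := by
  rw [augConj, ← submatrix_mul_equiv M N _ (Equiv.sumComm n n), mconj, Matrix.map_mul]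
  rfl

lemma augConj_conjTranspose (M : Matrix (m ⊕ m) (n ⊕ n) ℂ) : augConj Mᴴ = (augConj M)ᴴ := rfl

lemma augConj_add (M N : Matrix (m ⊕ m) (n ⊕ n) ℂ) :
    augConj (M + N) = augConj M + augConj N := by
  ext; simp [augConj, mconj]

lemma augConj_sub (M N : Matrix (m ⊕ m) (n ⊕ n) ℂ) :
    augConj (M - N) = augConj M - augConj N := by
  ext; simp [augConj, mconj]

lemma augConj_smul (r : ℝ) (M : Matrix (m ⊕ m) (n ⊕ n) ℂ) :
    augConj ((r : ℂ) • M) = (r : ℂ) • augConj M := by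
  ext; simp [augConj, mconj]

lemma augConj_one [DecidableEq n] : augConj (1 : Matrix (n ⊕ n) (n ⊕ n) ℂ) = 1 := by
  rw [augConj, submatrix_one_equiv, mconj, Matrix.map_one _ (map_zero _) (map_one _)]

lemma augConj_augConj (M : Matrix (m ⊕ m) (n ⊕ n) ℂ) : augConj (augConj M) = M := by
  ext; simp [augConj, mconj]

lemma augConj_inv [Fintype n] [DecidableEq n] {M : Matrix (n ⊕ n) (n ⊕ n) ℂ}
    (hM : IsUnit M.det) : augConj M⁻¹ = (augConj M)⁻¹ :=
  (inv_eq_left_inv (by rw [← augConj_mul, nonsing_inv_mul _ hM, augConj_one])).symm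

lemma trace_augConj [Fintype n] (M : Matrix (n ⊕ n) (n ⊕ n) ℂ) :
    (augConj M).trace = starRingEnd ℂ M.trace := by
  simp [augConj, mconj, trace, add_comm]

lemma Matrix.PosSemidef.augConj {M : Matrix (n ⊕ n) (n ⊕ n) ℂ} (hM : M.PosSemidef) :
    (_root_.augConj M).PosSemidef :=
  (hM.submatrix _).conjTranspose.transpose

lemma augConj_fromBlocks (A B : Matrix m n ℂ) :
    augConj (fromBlocks A B (mconj B) (mconj A)) = fromBlocks A B (mconj B) (mconj A) := by
  ext (i | i) (j | j) <;> simp [augConj, mconj]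

lemma augConj_augChannel {a b : ℕ} (H : Matrix (Fin a) (Fin b) ℂ) :
    augConj (augChannel H) = augChannel H := by
  have : augChannel H = fromBlocks H 0 (mconj 0) (mconj H) := by simp [augChannel, mconj]
  rw [this, augConj_fromBlocks]

lemma eq_fromBlocks_of_augConj_eq {M : Matrix (m ⊕ m) (n ⊕ n) ℂ} (hM : augConj M = M) :
    M = fromBlocks M.toBlocks₁₁ M.toBlocks₁₂ (mconj M.toBlocks₁₂) (mconj M.toBlocks₁₁) := by
  conv_lhs => rw [← fromBlocks_toBlocks M]
  congr 1
  · conv_lhs => rw [← hM]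
    rfl
  · conv_lhs => rw [← hM]
    rfl

end AugConj

lemma mem_feasibleGeneral_iff {nt : ℕ} {P : ℝ} {M : Matrix (Fin nt ⊕ Fin nt) (Fin nt ⊕ Fin nt) ℂ} :
    M ∈ feasibleGeneral nt P ↔ M.PosSemidef ∧ augConj M = M ∧ M.trace.re ≤ 2 * P := by
  constructor
  · rintro ⟨K, Kt, -, -, rfl, hM, htr⟩
    exact ⟨hM, augConj_fromBlocks _ _, htr⟩
  · rintro ⟨hM, haug, htr⟩
    refine ⟨M.toBlocks₁₁, M.toBlocks₁₂, hM.submatrix Sum.inl, ?_,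
      eq_fromBlocks_of_augConj_eq haug, hM, htr⟩
    ext i j
    have h1 := congrFun (congrFun haug (Sum.inl j)) (Sum.inr i)
    have h2 := hM.1.apply (Sum.inr i) (Sum.inl j)
    have h3 : starRingEnd ℂ (M (Sum.inr j) (Sum.inl i)) = M (Sum.inl j) (Sum.inr i) := h1
    rw [← hM.1.apply, starRingEnd_apply, star_star] at h3
    exact h3.symm

section Compactness

variable {n : Type*} [Fintype n] [DecidableEq n]

lemma isCompact_posSemidef_trace_le (c : ℝ) :
    IsCompact {M : Matrix n n ℂ | M.PosSemidef ∧ M.trace.re ≤ c} := by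
  have htr : ∀ B : Matrix n n ℂ, (Bᴴ * B).trace.re = ∑ j, ∑ i, ‖B i j‖ ^ 2 := by
    intro B
    simp [trace, mul_apply, ← Complex.normSq_eq_norm_sq, Complex.normSq_apply]
  have himage : {M : Matrix n n ℂ | M.PosSemidef ∧ M.trace.re ≤ c} =
      (fun B : Matrix n n ℂ => Bᴴ * B) '' {B | (Bᴴ * B).trace.re ≤ c} := by
    ext M
    constructor
    · rintro ⟨hM, hc⟩
      obtain ⟨B, rfl⟩ := hM.exists_eq_conjTranspose_mul_self_s13
      exact ⟨B, hc, rfl⟩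
    · rintro ⟨B, hB, rfl⟩
      exact ⟨posSemidef_conjTranspose_mul_self B, hB⟩
  rw [himage]
  have hcont : Continuous fun B : Matrix n n ℂ => Bᴴ * B := by fun_prop
  refine IsCompact.image ?_ hcont
  have hbox : IsCompact (Set.univ.pi fun _ : n => Set.univ.pi fun _ : n =>
      Metric.closedBall (0 : ℂ) (Real.sqrt c)) :=
    isCompact_univ_pi fun _ => isCompact_univ_pi fun _ => isCompact_closedBall _ _
  refine IsCompact.of_isClosed_subset hbox
    (isClosed_le (Complex.continuous_re.comp hcont.matrix_trace) continuous_const) ?_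
  intro B hB i _ j _
  rw [mem_closedBall_zero_iff]
  refine Real.le_sqrt_of_sq_le (le_trans ?_ ((htr B).symm.trans_le hB))
  calc ‖B i j‖ ^ 2 ≤ ∑ i, ‖B i j‖ ^ 2 :=
        Finset.single_le_sum (f := fun i => ‖B i j‖ ^ 2) (fun _ _ => by positivity)
          (Finset.mem_univ i)
    _ ≤ _ := Finset.single_le_sum (f := fun j => ∑ i, ‖B i j‖ ^ 2) (fun _ _ => by positivity)
          (Finset.mem_univ j)

lemma continuousOn_logDetOneAdd {W : Matrix n n ℂ} (hW : W.PosSemidef) :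
    ContinuousOn (logDetOneAdd W) {M | M.PosSemidef} := by
  have hcont : Continuous fun M : Matrix n n ℂ => (1 + W * M).det.re :=
    Complex.continuous_re.comp (Continuous.matrix_det (by fun_prop))
  exact hcont.continuousOn.log fun M hM => (hW.det_one_add_mul_re_pos hM).ne'

end Compactness

lemma isCompact_feasibleGeneral (nt : ℕ) (P : ℝ) : IsCompact (feasibleGeneral nt P) := by
  have hset : feasibleGeneral nt P = {M | M.PosSemidef ∧ M.trace.re ≤ 2 * P} ∩
      {M | augConj M = M} := by
    ext M
    rw [mem_feasibleGeneral_iff]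
    simp only [Set.mem_inter_iff, Set.mem_ofPred_eq]
    tauto
  rw [hset]
  refine (isCompact_posSemidef_trace_le _).inter_right (isClosed_eq ?_ continuous_id)
  exact (continuous_id.matrix_submatrix _ _).matrix_map Complex.continuous_conj

lemma det_one_add_mul_mul_comm {m n : Type*} [Fintype m] [DecidableEq m] [Fintype n]
    [DecidableEq n] (Y : Matrix m n ℂ) (M : Matrix n n ℂ) (Z : Matrix n m ℂ) :
    (1 + Y * M * Z).det = (1 + Z * Y * M).det := by
  rw [det_one_add_mul_comm, ← Matrix.mul_assoc]

section Secrecy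

variable {nt nr ne : ℕ}

lemma augConj_mul_inv_one_add_mul {W K : Matrix (Fin nt ⊕ Fin nt) (Fin nt ⊕ Fin nt) ℂ}
    (hW : W.PosSemidef) (hK : K.PosSemidef) (hWc : augConj W = W) (hKc : augConj K = K) :
    augConj (W * (1 + K * W)⁻¹) = W * (1 + K * W)⁻¹ := by
  rw [augConj_mul, augConj_inv (hK.isUnit_det_one_add_mul hW), augConj_add, augConj_one,
    augConj_mul, hWc, hKc]

/-- The convex symmetrization of a covariance matrix is a feasible augmented covariance matrix. -/
lemma half_smul_add_augConj_mem {P : ℝ} {K : Matrix (Fin nt ⊕ Fin nt) (Fin nt ⊕ Fin nt) ℂ}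
    (hK : K.PosSemidef) (htr : K.trace.re ≤ 2 * P) :
    ((1 / 2 : ℝ) : ℂ) • (K + augConj K) ∈ feasibleGeneral nt P := by
  rw [mem_feasibleGeneral_iff]
  refine ⟨(hK.add hK.augConj).smul (Complex.zero_le_real.mpr (by norm_num)), ?_, ?_⟩
  · rw [augConj_smul, augConj_add, augConj_augConj, add_comm]
  · rw [trace_smul, trace_add, trace_augConj, smul_eq_mul, Complex.re_ofReal_mul, Complex.add_re,
      Complex.conj_re]
    linarith

/-- Augmented version of channel enhancement at a maximizer of the secrecy rate. -/
lemma exists_enhanced_augmented_channel {P : ℝ} (hP : 0 < P)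
    {W₁ W₂ K₀ : Matrix (Fin nt ⊕ Fin nt) (Fin nt ⊕ Fin nt) ℂ}
    (hW₁ : W₁.PosSemidef) (hW₂ : W₂.PosSemidef) (hc₁ : augConj W₁ = W₁) (hc₂ : augConj W₂ = W₂)
    (hK₀ : K₀ ∈ feasibleGeneral nt P)
    (hmax : ∀ K ∈ feasibleGeneral nt P,
      logDetOneAdd W₁ K - logDetOneAdd W₂ K ≤ logDetOneAdd W₁ K₀ - logDetOneAdd W₂ K₀) :
    ∃ W : Matrix (Fin nt ⊕ Fin nt) (Fin nt ⊕ Fin nt) ℂ, augConj W = W ∧ W.PosSemidef ∧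
      (W - W₁).PosSemidef ∧ (W - W₂).PosSemidef ∧
      ∀ K ∈ feasibleGeneral nt P,
        logDetOneAdd W K - logDetOneAdd W₂ K ≤ logDetOneAdd W₁ K₀ - logDetOneAdd W₂ K₀ := by
  obtain ⟨hK₀p, hK₀c, hK₀t⟩ := mem_feasibleGeneral_iff.mp hK₀
  have hDc : augConj (W₁ * (1 + K₀ * W₁)⁻¹ - W₂ * (1 + K₀ * W₂)⁻¹) =
      W₁ * (1 + K₀ * W₁)⁻¹ - W₂ * (1 + K₀ * W₂)⁻¹ := by
    rw [augConj_sub, augConj_mul_inv_one_add_mul hW₁ hK₀p hc₁ hK₀c,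
      augConj_mul_inv_one_add_mul hW₂ hK₀p hc₂ hK₀c]
  obtain ⟨c, M, hM, hMp, hdeg, hle⟩ := exists_enhanced_channel (P := 2 * P) (by positivity)
    hW₁ hW₂ hK₀p hK₀t fun K hK htr => by
      have hS := half_smul_add_augConj_mem hK htr
      have hgrad := trace_gradient_mul_sub_nonpos hW₁ hW₂ (mem_feasibleGeneral_iff.mp hS).1 hK₀p
        fun t ht0 ht1 => hmax _ (by
          obtain ⟨hSp, hSc, hSt⟩ := mem_feasibleGeneral_iff.mp hS
          generalize ((1 / 2 : ℝ) : ℂ) • (K + augConj K) = S at hSp hSc hSt ⊢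
          have hconv : K₀ + (t : ℂ) • (S - K₀) = ((1 - t : ℝ) : ℂ) • K₀ + (t : ℂ) • S := by
            push_cast; module
          rw [mem_feasibleGeneral_iff, hconv]
          refine ⟨(hK₀p.smul (Complex.zero_le_real.mpr (sub_nonneg.mpr ht1))).add
            (hSp.smul (Complex.zero_le_real.mpr ht0.le)), ?_, ?_⟩
          · rw [augConj_add, augConj_smul, augConj_smul, hK₀c, hSc]
          · rw [trace_add, trace_smul, trace_smul, smul_eq_mul, smul_eq_mul, Complex.add_re,
              Complex.re_ofReal_mul, Complex.re_ofReal_mul]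
            nlinarith)
      have hDK : ((W₁ * (1 + K₀ * W₁)⁻¹ - W₂ * (1 + K₀ * W₂)⁻¹) * augConj K).trace.re =
          ((W₁ * (1 + K₀ * W₁)⁻¹ - W₂ * (1 + K₀ * W₂)⁻¹) * K).trace.re := by
        conv_lhs => rw [← hDc, ← augConj_mul, trace_augConj, Complex.conj_re]
      rw [mul_sub, trace_sub, Complex.sub_re, mul_smul_comm, trace_smul, smul_eq_mul,
        Complex.re_ofReal_mul, mul_add, trace_add, Complex.add_re, hDK] at hgrad
      rw [mul_sub, trace_sub, Complex.sub_re]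
      linarith
  refine ⟨W₁ + M, ?_, hW₁.add hMp, by simpa using hMp, hdeg, fun K hK => ?_⟩
  · rw [hM, augConj_add, augConj_sub, augConj_smul, augConj_one, hDc, hc₁]
  · exact hle K (mem_feasibleGeneral_iff.mp hK).1 (mem_feasibleGeneral_iff.mp hK).2.2

lemma zero_mem_feasibleGeneral {P : ℝ} (hP : 0 < P) : 0 ∈ feasibleGeneral nt P := by
  rw [mem_feasibleGeneral_iff]
  refine ⟨PosSemidef.zero, ?_, by simpa using hP.le⟩
  ext; simp [augConj, mconj]

lemma one_mem_feasibleNoiseCorr : 1 ∈ feasibleNoiseCorr nr ne :=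
  ⟨0, 0, by simp [mconj, fromBlocks_one], PosDef.one⟩

/-- Noise correlations that make the joint channel arbitrarily close to a given channel which
is better than both the legitimate channel and that of the eavesdropper. -/
lemma exists_mem_feasibleNoiseCorr {Hr : Matrix (Fin nr) (Fin nt) ℂ}
    {He : Matrix (Fin ne) (Fin nt) ℂ} {W : Matrix (Fin nt ⊕ Fin nt) (Fin nt ⊕ Fin nt) ℂ}
    (hWc : augConj W = W) (hW : W.PosSemidef)
    (h₁ : (W - (augChannel Hr)ᴴ * augChannel Hr).PosSemidef)
    (h₂ : (W - (augChannel He)ᴴ * augChannel He).PosSemidef) {ε : ℝ} (hε : 0 < ε) :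
    ∃ Q ∈ feasibleNoiseCorr nr ne, (((1 + ε : ℝ) : ℂ) • (W + (ε : ℂ) • 1) -
      (fromRows (augChannel Hr) (augChannel He))ᴴ * Q⁻¹ *
        fromRows (augChannel Hr) (augChannel He)).PosSemidef := by
  have hεp : ((ε : ℂ) • (1 : Matrix (Fin nt ⊕ Fin nt) (Fin nt ⊕ Fin nt) ℂ)).PosDef :=
    PosDef.one.smul (Complex.zero_lt_real.mpr hε)
  have hZ : (W + (ε : ℂ) • 1).PosDef := hεp.posSemidef_add hW
  have hadd : ∀ V : Matrix (Fin nt ⊕ Fin nt) (Fin nt ⊕ Fin nt) ℂ, (W - V).PosSemidef →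
      (W + (ε : ℂ) • 1 - V).PosSemidef := fun V hV => by
    simpa [sub_add_eq_add_sub] using hV.add hεp.posSemidef
  obtain ⟨hQ, hle⟩ := posDef_noiseCorrelation hZ (hadd _ h₁) (hadd _ h₂)
    (inv_pos.mpr (by positivity : 0 < 1 + ε)) (inv_lt_one_of_one_lt₀ (by linarith)) rfl
  rw [inv_inv] at hle
  refine ⟨_, ?_, hle⟩
  have haug : augConj ((((1 + ε)⁻¹ : ℝ) : ℂ) •
      (augChannel Hr * (W + (ε : ℂ) • 1)⁻¹ * (augChannel He)ᴴ)) =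
      (((1 + ε)⁻¹ : ℝ) : ℂ) • (augChannel Hr * (W + (ε : ℂ) • 1)⁻¹ * (augChannel He)ᴴ) := by
    rw [augConj_smul, augConj_mul, augConj_mul, augConj_conjTranspose, augConj_augChannel,
      augConj_augChannel, augConj_inv ((isUnit_iff_isUnit_det _).mp hZ.isUnit), augConj_add,
      augConj_smul, augConj_one, hWc]
  have hform := eq_fromBlocks_of_augConj_eq haug
  exact ⟨_, _, by rw [← hform], hQ⟩

end Secrecy

/-- **Min-max reformulation of the secrecy capacity of the general complex MIMO wiretap
channel.** The supremum over augmented covariance matrices of the secrecy rate equals the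
infimum over augmented noise correlation matrices `Q̲` of the supremum over augmented
covariance matrices of
`(1/2)·log det(I + Q̲⁻¹ H̲ K̲ H̲ᴴ) − (1/2)·log det(I + H̲ₑ K̲ H̲ₑᴴ)`, where
`H̲ = [H̲ᵣ; H̲ₑ]`. -/
theorem secrecy_capacity_minmax_reformulation (nt nr ne : ℕ)
    (Hr : Matrix (Fin nr) (Fin nt) ℂ) (He : Matrix (Fin ne) (Fin nt) ℂ)
    (P : ℝ) (hP : 0 < P) :
    sSup ((fun M : Matrix (Fin nt ⊕ Fin nt) (Fin nt ⊕ Fin nt) ℂ =>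
        (1 / 2) * Real.log ((1 + augChannel Hr * M * (augChannel Hr)ᴴ).det).re
        - (1 / 2) * Real.log ((1 + augChannel He * M * (augChannel He)ᴴ).det).re) ''
      feasibleGeneral nt P)
    = sInf ((fun Q : Matrix ((Fin nr ⊕ Fin nr) ⊕ (Fin ne ⊕ Fin ne))
          ((Fin nr ⊕ Fin nr) ⊕ (Fin ne ⊕ Fin ne)) ℂ =>
        sSup ((fun M : Matrix (Fin nt ⊕ Fin nt) (Fin nt ⊕ Fin nt) ℂ =>
          (1 / 2) * Real.log ((1 + Q⁻¹ *
            Matrix.fromRows (augChannel Hr) (augChannel He) * M *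
            (Matrix.fromRows (augChannel Hr) (augChannel He))ᴴ).det).re
          - (1 / 2) * Real.log ((1 + augChannel He * M * (augChannel He)ᴴ).det).re) ''
          feasibleGeneral nt P)) '' feasibleNoiseCorr nr ne) := by
  simp only [det_one_add_mul_mul_comm, ← Matrix.mul_assoc]
  change sSup ((fun M => 1 / 2 * logDetOneAdd ((augChannel Hr)ᴴ * augChannel Hr) M -
      1 / 2 * logDetOneAdd ((augChannel He)ᴴ * augChannel He) M) '' _) =
    sInf ((fun Q => sSup ((fun M => 1 / 2 * logDetOneAdd
      ((fromRows (augChannel Hr) (augChannel He))ᴴ * Q⁻¹ *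
        fromRows (augChannel Hr) (augChannel He)) M -
      1 / 2 * logDetOneAdd ((augChannel He)ᴴ * augChannel He) M) '' _)) '' _)
  have hW₁ := posSemidef_conjTranspose_mul_self (augChannel Hr)
  have hW₂ := posSemidef_conjTranspose_mul_self (augChannel He)
  have hgram : ∀ {a : ℕ} (H : Matrix (Fin a) (Fin nt) ℂ),
      augConj ((augChannel H)ᴴ * augChannel H) = (augChannel H)ᴴ * augChannel H := fun H => by
    rw [augConj_mul, augConj_conjTranspose, augConj_augChannel]
  have hH : ∀ Q ∈ feasibleNoiseCorr nr ne,
      (((fromRows (augChannel Hr) (augChannel He))ᴴ * Q⁻¹ *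
        fromRows (augChannel Hr) (augChannel He)) -
          (augChannel Hr)ᴴ * augChannel Hr).PosSemidef := by
    rintro Q ⟨A, B, rfl, hQ⟩
    exact posSemidef_joint_sub_first hQ
  have hHp : ∀ Q ∈ feasibleNoiseCorr nr ne,
      ((fromRows (augChannel Hr) (augChannel He))ᴴ * Q⁻¹ *
        fromRows (augChannel Hr) (augChannel He)).PosSemidef := by
    rintro Q ⟨A, B, -, hQ⟩
    exact hQ.inv.posSemidef.conjTranspose_mul_mul_same _
  set W₁ := (augChannel Hr)ᴴ * augChannel Hr
  set W₂ := (augChannel He)ᴴ * augChannel He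
  set F := feasibleGeneral nt P
  have hFp : ∀ K ∈ F, K.PosSemidef := fun K hK => (mem_feasibleGeneral_iff.mp hK).1
  have hFc : IsCompact F := isCompact_feasibleGeneral nt P
  have hF0 : F.Nonempty := ⟨0, zero_mem_feasibleGeneral hP⟩
  have hcont : ∀ W : Matrix (Fin nt ⊕ Fin nt) (Fin nt ⊕ Fin nt) ℂ, W.PosSemidef →
      ContinuousOn (fun M => 1 / 2 * logDetOneAdd W M - 1 / 2 * logDetOneAdd W₂ M) F :=
    fun W hW => (continuousOn_const.mul ((continuousOn_logDetOneAdd hW).mono hFp)).sub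
      (continuousOn_const.mul ((continuousOn_logDetOneAdd hW₂).mono hFp))
  have hlower : ∀ Q ∈ feasibleNoiseCorr nr ne,
      sSup ((fun M => 1 / 2 * logDetOneAdd W₁ M - 1 / 2 * logDetOneAdd W₂ M) '' F) ≤
        sSup ((fun M => 1 / 2 * logDetOneAdd ((fromRows (augChannel Hr) (augChannel He))ᴴ * Q⁻¹ *
          fromRows (augChannel Hr) (augChannel He)) M - 1 / 2 * logDetOneAdd W₂ M) '' F) := by
    intro Q hQ
    refine csSup_le (hF0.image _) ?_
    rintro _ ⟨K, hK, rfl⟩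
    refine le_csSup_of_le (hFc.image_of_continuousOn (hcont _ (hHp Q hQ))).bddAbove
      ⟨K, hK, rfl⟩ ?_
    have := logDetOneAdd_mono hW₁ (hH Q hQ) (hFp K hK)
    dsimp only
    linarith
  refine le_antisymm (le_csInf ⟨_, 1, one_mem_feasibleNoiseCorr, rfl⟩ ?_) ?_
  · rintro _ ⟨Q, hQ, rfl⟩
    exact hlower Q hQ
  obtain ⟨K₀, hK₀, hmax⟩ := hFc.exists_isMaxOn hF0 (hcont W₁ hW₁)
  have hmax' : ∀ K ∈ F, logDetOneAdd W₁ K - logDetOneAdd W₂ K ≤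
      logDetOneAdd W₁ K₀ - logDetOneAdd W₂ K₀ := fun K hK => by
    have : 1 / 2 * logDetOneAdd W₁ K - 1 / 2 * logDetOneAdd W₂ K ≤
      1 / 2 * logDetOneAdd W₁ K₀ - 1 / 2 * logDetOneAdd W₂ K₀ := hmax hK
    linarith
  obtain ⟨W, hWc, hW, h₁, h₂, hle⟩ :=
    exists_enhanced_augmented_channel hP hW₁ hW₂ (hgram Hr) (hgram He) hK₀ hmax'
  obtain ⟨b, hb⟩ := (hFc.image (f := fun K => (K * (W + (2 : ℂ) • 1)).trace.re)
    (Complex.continuous_re.comp (Continuous.matrix_trace (by fun_prop)))).bddAbove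
  have hb' : ∀ K ∈ F, (K * W).trace.re + 2 * K.trace.re ≤ b := fun K hK => by
    simpa [mul_add] using hb ⟨K, hK, rfl⟩
  have hupper : ∀ ε : ℝ, 0 < ε → ε ≤ 1 →
      sInf ((fun Q => sSup ((fun M => 1 / 2 * logDetOneAdd
        ((fromRows (augChannel Hr) (augChannel He))ᴴ * Q⁻¹ *
          fromRows (augChannel Hr) (augChannel He)) M - 1 / 2 * logDetOneAdd W₂ M) '' F)) ''
            feasibleNoiseCorr nr ne) ≤
        sSup ((fun M => 1 / 2 * logDetOneAdd W₁ M - 1 / 2 * logDetOneAdd W₂ M) '' F) +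
          ε * (b / 2) := by
    intro ε hε0 hε1
    obtain ⟨Q, hQ, hZ⟩ := exists_mem_feasibleNoiseCorr hWc hW h₁ h₂ hε0
    refine csInf_le_of_le ⟨_, by rintro _ ⟨Q, hQ, rfl⟩; exact hlower Q hQ⟩ ⟨Q, hQ, rfl⟩
      (csSup_le (hF0.image _) ?_)
    rintro _ ⟨K, hK, rfl⟩
    have hKp := hFp K hK
    have hU : (W + ((1 + ε : ℝ) : ℂ) • 1).PosSemidef :=
      hW.add (PosSemidef.one.smul (Complex.zero_le_real.mpr (by positivity)))
    have hsplit : ((1 + ε : ℝ) : ℂ) • (W + (ε : ℂ) • 1) =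
        W + (ε : ℂ) • (W + ((1 + ε : ℝ) : ℂ) • 1) := by
      push_cast; module
    have hmono := logDetOneAdd_mono (hHp Q hQ) hZ hKp
    have hadd := logDetOneAdd_add_le hW (hU.smul (Complex.zero_le_real.mpr hε0.le)) hKp
    rw [hsplit] at hmono
    have htr : (K * ((ε : ℂ) • (W + ((1 + ε : ℝ) : ℂ) • 1))).trace.re =
        ε * ((K * W).trace.re + (1 + ε) * K.trace.re) := by
      rw [mul_smul_comm, mul_add, mul_smul_comm, mul_one, trace_smul, trace_add, trace_smul,
        smul_eq_mul, smul_eq_mul, Complex.re_ofReal_mul, Complex.add_re, Complex.re_ofReal_mul]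
    have htrb : (K * W).trace.re + (1 + ε) * K.trace.re ≤ b := by
      have := (Complex.le_def.mp hKp.trace_nonneg).1
      rw [Complex.zero_re] at this
      nlinarith [hb' K hK]
    have hbound := mul_le_mul_of_nonneg_left htrb hε0.le
    have hsup := le_csSup (hFc.image_of_continuousOn (hcont W₁ hW₁)).bddAbove
      (Set.mem_image_of_mem _ hK₀)
    have := hle K hK
    dsimp only at hsup ⊢
    linarith
  have hlim : Filter.Tendsto (fun ε : ℝ =>
      sSup ((fun M => 1 / 2 * logDetOneAdd W₁ M - 1 / 2 * logDetOneAdd W₂ M) '' F) +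
        ε * (b / 2)) (nhdsWithin 0 (Set.Ioi 0))
      (nhds (sSup ((fun M => 1 / 2 * logDetOneAdd W₁ M - 1 / 2 * logDetOneAdd W₂ M) '' F))) := by
    refine Filter.Tendsto.mono_left ?_ nhdsWithin_le_nhds
    exact Continuous.tendsto' (by fun_prop) _ _ (by simp)
  refine ge_of_tendsto hlim ?_
  filter_upwards [Ioc_mem_nhdsGT (zero_lt_one' ℝ)] with ε hε
  exact hupper ε hε.1 hε.2
end
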